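/- Let d ≥ 4 and let P be a simplicial d-polytope in ℝ^d with natural embedding p. Let τ be a missing face of ∂P with 3 ≤ |τ| ≤ d−1, let e be a 2-element subset of τ (which is an edge of ∂P), and set τ' = τ \ e. Then there exists a stress on the framework (H, p), where H is the graph of the star st(τ') together with the additional edge e, that is nonzero on e. -/

import Mathlib

open Finset
open scoped Classical

noncomputable section

/-- A finite graph: a finite vertex set together with a finite set of edges,
where each edge is (intended to be) a 2-element subset of the vertex set. -/
structure FinGraph (ι : Type) where
  verts : Finset ι
  edges : Finset (Finset ι)

/-- Every edge is a 2-element subset of the vertex set. -/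
def FinGraph.Good {ι : Type} (G : FinGraph ι) : Prop :=
  ∀ e ∈ G.edges, e ⊆ G.verts ∧ e.card = 2

/-- The standard inner (dot) product on `ℝ^d`. -/
def dotR {d : ℕ} (x y : Fin d → ℝ) : ℝ := ∑ i, x i * y i

/-- An infinitesimal motion of the framework `(G, p)`. -/
def IsMotion {ι : Type} {d : ℕ} (G : FinGraph ι) (p m : ι → Fin d → ℝ) : Prop :=
  ∀ e ∈ G.edges, ∀ u ∈ e, ∀ v ∈ e, dotR (p u - p v) (m u - m v) = 0

/-- The framework `(G, p)` is infinitesimally rigid in `ℝ^d`: every infinitesimal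
motion is the restriction of a motion `x ↦ A x + b` of `ℝ^d` with `A` skew-symmetric. -/
def IsInfRigid {ι : Type} (d : ℕ) (G : FinGraph ι) (p : ι → Fin d → ℝ) : Prop :=
  ∀ m : ι → Fin d → ℝ, IsMotion G p m →
    ∃ (A : Matrix (Fin d) (Fin d) ℝ) (b : Fin d → ℝ),
      A.transpose = -A ∧ ∀ v ∈ G.verts, m v = A.mulVec (p v) + b

/-- A stress on the framework `(G, p)`. -/
def IsStress {ι : Type} {d : ℕ} (G : FinGraph ι) (p : ι → Fin d → ℝ)
    (ω : Finset ι → ℝ) : Prop :=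
  ∀ v ∈ G.verts,
    (∑ e ∈ G.edges.filter (fun e => v ∈ e), ∑ u ∈ e.erase v, ω e • (p v - p u)) = 0

/-- A centrally symmetric framework with free involution `ν` satisfying `p (ν v) = -(p v)`. -/
def IsCSFramework {ι : Type} {d : ℕ} (G : FinGraph ι) (p : ι → Fin d → ℝ) (ν : ι → ι) : Prop :=
  (∀ v ∈ G.verts, ν (ν v) = v) ∧
  (∀ v ∈ G.verts, ν v ∈ G.verts) ∧
  (∀ v ∈ G.verts, ν v ≠ v) ∧
  (∀ e ∈ G.edges, e.image ν ∈ G.edges) ∧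
  (∀ e ∈ G.edges, e.image ν ≠ e) ∧
  (∀ v ∈ G.verts, p (ν v) = -(p v))

/-- The convex body spanned by a finite point set. -/
def polyBody {d : ℕ} (V : Finset (Fin d → ℝ)) : Set (Fin d → ℝ) :=
  convexHull ℝ (V : Set (Fin d → ℝ))

/-- `(f, c)` is a supporting functional for `conv V` exposing the face `F`. -/
def IsSupport {d : ℕ} (V : Finset (Fin d → ℝ)) (f : (Fin d → ℝ) →ₗ[ℝ] ℝ) (c : ℝ)
    (F : Set (Fin d → ℝ)) : Prop :=
  (∀ y ∈ polyBody V, f y ≤ c) ∧ F = {y ∈ polyBody V | f y = c}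

/-- A proper face of the polytope `conv V`. -/
def IsProperFace {d : ℕ} (V : Finset (Fin d → ℝ)) (F : Set (Fin d → ℝ)) : Prop :=
  (∃ f c, IsSupport V f c F) ∧ F ≠ polyBody V

/-- A simplicial `d`-polytope in `ℝ^d`, recorded by its vertex set `V`: the polytope is
`conv V`, it is `d`-dimensional, every element of `V` is a vertex, and every proper face
is a simplex (the convex hull of its affinely independent vertex set). -/
structure SPolytope (d : ℕ) where
  V : Finset (Fin d → ℝ)
  span_top : affineSpan ℝ (V : Set (Fin d → ℝ)) = ⊤
  extreme : ∀ v ∈ V, v ∉ convexHull ℝ ((V.erase v : Finset (Fin d → ℝ)) : Set (Fin d → ℝ))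
  simplicial : ∀ F : Set (Fin d → ℝ), IsProperFace V F →
    AffineIndependent ℝ
      (fun x : {y : Fin d → ℝ // y ∈ (V : Set (Fin d → ℝ)) ∩ F} => (x : Fin d → ℝ)) ∧
    F = convexHull ℝ ((V : Set (Fin d → ℝ)) ∩ F)

/-- `s` is a face of the boundary complex `∂P`. -/
def BFace {d : ℕ} (P : SPolytope d) (s : Finset (Fin d → ℝ)) : Prop :=
  s ⊆ P.V ∧ ∃ F : Set (Fin d → ℝ), IsProperFace P.V F ∧ (s : Set (Fin d → ℝ)) ⊆ F

/-- The number of vertices of `∂P`. -/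
def f0 {d : ℕ} (P : SPolytope d) : ℕ := P.V.card

/-- The edges of `∂P`. -/
def edgeFinset {d : ℕ} (P : SPolytope d) : Finset (Finset (Fin d → ℝ)) :=
  P.V.powerset.filter fun e => e.card = 2 ∧ BFace P e

/-- The number of edges of `∂P`. -/
def f1 {d : ℕ} (P : SPolytope d) : ℕ := (edgeFinset P).card

/-- `g₂(P) = f₁ - d f₀ + C(d+1, 2)`. -/
def g2 {d : ℕ} (P : SPolytope d) : ℤ :=
  (f1 P : ℤ) - (d : ℤ) * (f0 P : ℤ) + ((d + 1).choose 2 : ℤ)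

/-- `P` is centrally symmetric. -/
def IsCS {d : ℕ} (P : SPolytope d) : Prop := ∀ v ∈ P.V, -v ∈ P.V

/-- A missing face of `∂P`. -/
def IsMissingFace {d : ℕ} (P : SPolytope d) (σ : Finset (Fin d → ℝ)) : Prop :=
  σ ⊆ P.V ∧ ¬ BFace P σ ∧ ∀ τ ⊂ σ, BFace P τ

/-- `P` is prime: `∂P` has no missing facet, i.e. no missing face of cardinality `d`. -/
def IsPrimePoly {d : ℕ} (P : SPolytope d) : Prop :=
  ¬ ∃ σ : Finset (Fin d → ℝ), IsMissingFace P σ ∧ σ.card = d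

/-- The graph (1-skeleton) of `∂P` as a framework graph. -/
def fullGraph {d : ℕ} (P : SPolytope d) : FinGraph (Fin d → ℝ) :=
  ⟨P.V, edgeFinset P⟩

/-- The graph (1-skeleton) of the star of the face `τ` in `∂P`. -/
def starGraph {d : ℕ} (P : SPolytope d) (τ : Finset (Fin d → ℝ)) : FinGraph (Fin d → ℝ) :=
  ⟨P.V.filter fun v => BFace P (insert v τ),
   P.V.powerset.filter fun e => e.card = 2 ∧ BFace P (e ∪ τ)⟩

/-- Adjacency in the graph of `∂P`. -/
def Adj {d : ℕ} (P : SPolytope d) (u v : Fin d → ℝ) : Prop :=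
  u ≠ v ∧ BFace P {u, v}

/-- `σ` is a face of the link of the face `τ` in `∂P`. -/
def LinkFace {d : ℕ} (P : SPolytope d) (τ σ : Finset (Fin d → ℝ)) : Prop :=
  Disjoint σ τ ∧ BFace P (σ ∪ τ)

/-- `P` is a `d`-dimensional cross-polytope: its vertex set is `{±b₁, …, ±b_d}`
for some basis `b₁, …, b_d` of `ℝ^d`. -/
def IsCrossPolytope {d : ℕ} (P : SPolytope d) : Prop :=
  ∃ b : Fin d → (Fin d → ℝ), LinearIndependent ℝ b ∧
    (P.V : Set (Fin d → ℝ)) = Set.range b ∪ Set.range (fun i => -(b i))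

/-- A facet of `P`: a proper face with `d` vertices. -/
def IsFacet {d : ℕ} (P : SPolytope d) (F : Set (Fin d → ℝ)) : Prop :=
  IsProperFace P.V F ∧ ((P.V : Set (Fin d → ℝ)) ∩ F).ncard = d

/-- `x` lies beyond exactly one facet of `P`: it is strictly separated from `P` by the
affine hull of one facet `F`, and not separated from `P` by the affine hull of any
other facet. -/
def BeyondExactlyOne {d : ℕ} (P : SPolytope d) (x : Fin d → ℝ) : Prop :=
  ∃ F : Set (Fin d → ℝ), IsFacet P F ∧
    (∀ f c, IsSupport P.V f c F → c < f x) ∧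
    (∀ F' : Set (Fin d → ℝ), IsFacet P F' → F' ≠ F →
      ∀ f c, IsSupport P.V f c F' → f x < c)

/-- `P` is obtained from a `d`-dimensional cross-polytope by symmetric stacking: there is
a sequence of cs simplicial `d`-polytopes starting at a cross-polytope and ending at `P`,
each obtained from the previous one as `conv (P_k ∪ {v, -v})` for a point `v` lying
beyond exactly one facet of `P_k`. -/
def SymmetricStackingFrom {d : ℕ} (P : SPolytope d) : Prop :=
  ∃ (m : ℕ) (Q : Fin (m + 1) → SPolytope d),
    (∀ k, IsCS (Q k)) ∧
    IsCrossPolytope (Q 0) ∧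
    Q (Fin.last m) = P ∧
    ∀ k : Fin m, ∃ v : Fin d → ℝ,
      BeyondExactlyOne (Q (Fin.castSucc k)) v ∧
      polyBody (Q (Fin.succ k)).V =
        convexHull ℝ (polyBody (Q (Fin.castSucc k)).V ∪ {v, -v})

/-- `P` is a stacked `d`-polytope: obtained from a `d`-simplex by repeatedly adding a
point beyond exactly one facet. -/
def IsStacked {d : ℕ} (P : SPolytope d) : Prop :=
  ∃ (m : ℕ) (R : Fin (m + 1) → SPolytope d),
    (R 0).V.card = d + 1 ∧
    R (Fin.last m) = P ∧
    ∀ k : Fin m, ∃ v : Fin d → ℝ,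
      BeyondExactlyOne (R (Fin.castSucc k)) v ∧
      polyBody (R (Fin.succ k)).V =
        convexHull ℝ (polyBody (R (Fin.castSucc k)).V ∪ {v})

/-- Every `d` vertices of `P`, no two of which are antipodal, are affinely independent. -/
def GenPos {d : ℕ} (P : SPolytope d) : Prop :=
  ∀ S : Finset (Fin d → ℝ), S ⊆ P.V → S.card = d →
    (∀ x ∈ S, ∀ y ∈ S, x ≠ -y) →
    AffineIndependent ℝ (fun s : {x : Fin d → ℝ // x ∈ S} => (s : Fin d → ℝ))

/-- The graph of the cone `v₀ * S` over a simplicial complex `S` (a set of finsets):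
the vertices of `S` together with `v₀`, and the edges of `S` together with all edges
from `v₀` to vertices of `S`. -/
def coneGraph {d : ℕ} (P : SPolytope d) (v0 : Fin d → ℝ)
    (S : Set (Finset (Fin d → ℝ))) : FinGraph (Fin d → ℝ) :=
  ⟨insert v0 (P.V.filter fun u => ({u} : Finset (Fin d → ℝ)) ∈ S),
   (P.V.powerset.filter fun e => e.card = 2 ∧ e ∈ S) ∪
     (P.V.filter fun u => ({u} : Finset (Fin d → ℝ)) ∈ S).image
       fun u => ({v0, u} : Finset (Fin d → ℝ))⟩

/-! ### Vectors in three-space -/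
namespace Rig

abbrev V3 := Fin 3 → ℝ

def dt (a b : V3) : ℝ := a 0 * b 0 + a 1 * b 1 + a 2 * b 2

def cr (a b : V3) : V3 :=
  ![a 1 * b 2 - a 2 * b 1, a 2 * b 0 - a 0 * b 2, a 0 * b 1 - a 1 * b 0]

def dd (a b c : V3) : ℝ := dt (cr a b) c

lemma cr0 (a b : V3) : cr a b 0 = a 1 * b 2 - a 2 * b 1 := rfl
lemma cr1 (a b : V3) : cr a b 1 = a 2 * b 0 - a 0 * b 2 := rfl
lemma cr2 (a b : V3) : cr a b 2 = a 0 * b 1 - a 1 * b 0 := rfl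

lemma v3_ext {a b : V3} (h0 : a 0 = b 0) (h1 : a 1 = b 1) (h2 : a 2 = b 2) : a = b := by
  funext i; fin_cases i <;> assumption

lemma dt_add (a b c : V3) : dt a (b + c) = dt a b + dt a c := by simp [dt]; ring
lemma dt_sub (a b c : V3) : dt a (b - c) = dt a b - dt a c := by simp [dt]; ring
lemma dt_smul (r : ℝ) (a b : V3) : dt a (r • b) = r * dt a b := by simp [dt]; ring
lemma dt_zero (a : V3) : dt a 0 = 0 := by simp [dt]
lemma zero_dt (a : V3) : dt 0 a = 0 := by simp [dt]
lemma add_dt (a b c : V3) : dt (a + b) c = dt a c + dt b c := by simp [dt]; ring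
lemma sub_dt (a b c : V3) : dt (a - b) c = dt a c - dt b c := by simp [dt]; ring
lemma neg_dt (a c : V3) : dt (-a) c = - dt a c := by simp [dt]; ring
lemma smul_dt (r : ℝ) (a b : V3) : dt (r • a) b = r * dt a b := by simp [dt]; ring
lemma dt_comm (a b : V3) : dt a b = dt b a := by simp [dt]; ring
lemma sum_dt {ι : Type} (s : Finset ι) (f : ι → V3) (b : V3) :
    dt (∑ i ∈ s, f i) b = ∑ i ∈ s, dt (f i) b := by
  induction s using Finset.induction_on with
  | empty => simp [zero_dt]
  | insert a s ha ih => rw [sum_insert ha, sum_insert ha, add_dt, ih]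
lemma dt_sum {ι : Type} (s : Finset ι) (f : ι → V3) (b : V3) :
    dt b (∑ i ∈ s, f i) = ∑ i ∈ s, dt b (f i) := by
  simp only [dt_comm b, sum_dt]
lemma dt_self_pos {a : V3} (h : a ≠ 0) : 0 < dt a a := by
  have h0 : 0 ≤ dt a a := by simp only [dt]; nlinarith [mul_self_nonneg (a 0), mul_self_nonneg (a 1), mul_self_nonneg (a 2)]
  rcases h0.lt_or_eq with h1 | h1
  · exact h1
  · exfalso; apply h
    simp only [dt] at h1
    apply v3_ext <;> simp <;> nlinarith [sq_nonneg (a 0), sq_nonneg (a 1), sq_nonneg (a 2)]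

lemma dd_cyc (a b c : V3) : dd a b c = dd b c a := by simp [dd, dt, cr0, cr1, cr2]; ring
lemma dd_swap (a b c : V3) : dd a b c = - dd b a c := by simp [dd, dt, cr0, cr1, cr2]; ring
lemma dd_self1 (a b : V3) : dd a b a = 0 := by simp [dd, dt, cr0, cr1, cr2]; ring
lemma dd_self2 (a b : V3) : dd a b b = 0 := by simp [dd, dt, cr0, cr1, cr2]; ring
lemma dd_self3 (a b : V3) : dd a a b = 0 := by simp [dd, dt, cr0, cr1, cr2]; ring

lemma cramer (u v w y : V3) :
    dd u v w • y = dt y u • cr v w + dt y v • cr w u + dt y w • cr u v := by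
  apply v3_ext <;> simp [dd, dt, cr0, cr1, cr2] <;> ring

lemma eq_zero_of_dt {u v w y : V3} (hd : dd u v w ≠ 0) (h1 : dt y u = 0) (h2 : dt y v = 0)
    (h3 : dt y w = 0) : y = 0 := by
  have := cramer u v w y
  rw [h1, h2, h3] at this
  simpa [hd] using this

lemma eq_of_dt {u v w y z : V3} (hd : dd u v w ≠ 0) (h1 : dt y u = dt z u) (h2 : dt y v = dt z v)
    (h3 : dt y w = dt z w) : y = z := by
  rw [← sub_eq_zero]
  apply eq_zero_of_dt hd <;> rw [sub_dt] <;> linarith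

lemma exists_mul_cr {u v w y : V3} (hd : dd u v w ≠ 0) (h1 : dt y u = 0) (h2 : dt y v = 0) :
    y = (dt y w / dd u v w) • cr u v := by
  have := cramer u v w y
  rw [h1, h2] at this
  simp only [zero_smul, zero_add] at this
  rw [div_eq_inv_mul, mul_smul, ← this, smul_smul, inv_mul_cancel₀ hd, one_smul]

lemma exists_dt {u v w : V3} (hd : dd u v w ≠ 0) (a b c : ℝ) :
    ∃ y, dt y u = a ∧ dt y v = b ∧ dt y w = c := by
  refine ⟨(dd u v w)⁻¹ • (a • cr v w + b • cr w u + c • cr u v), ?_, ?_, ?_⟩ <;>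
  · rw [smul_dt, inv_mul_eq_iff_eq_mul₀ hd]
    simp [dd, dt, cr0, cr1, cr2]; ring

lemma cr_eq_zero {a b : V3} (hb : b ≠ 0) (h : cr a b = 0) : ∃ c : ℝ, a = c • b := by
  refine ⟨dt a b / dt b b, ?_⟩
  have hp := dt_self_pos hb
  have h0 := congrFun h 0
  have h1 := congrFun h 1
  have h2 := congrFun h 2
  simp only [cr0, cr1, cr2, Pi.zero_apply] at h0 h1 h2
  rw [div_eq_inv_mul, mul_smul]
  have : dt b b • a = dt a b • b := by
    apply v3_ext <;> simp [dt]
    · linear_combination b 1 * (-h2 * (-1)) - b 2 * h1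
    · linear_combination b 2 * h0 - b 0 * h2
    · linear_combination b 0 * h1 - b 1 * h0
  rw [← this, smul_smul, inv_mul_cancel₀ hp.ne', one_smul]

lemma four_id (v e u w y : V3) :
    dt y u * dd v e w - dt y w * dd v e u = dt y e * dd v u w - dt y v * dd e u w := by
  simp [dd, dt, cr0, cr1, cr2]; ring

lemma cr_dt_left (a b : V3) : dt (cr a b) a = 0 := by simp [dt, cr0, cr1, cr2]; ring
lemma cr_dt_right (a b : V3) : dt (cr a b) b = 0 := by simp [dt, cr0, cr1, cr2]; ring

/-- an infinitesimal motion of a triangle is a rigid one -/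
lemma triangle {u v w mu mv mw : V3} (hd : dd u v w ≠ 0)
    (h1 : dt (u - v) (mu - mv) = 0) (h2 : dt (v - w) (mv - mw) = 0)
    (h3 : dt (w - u) (mw - mu) = 0) :
    ∃ ω β : V3, mu = cr ω u + β ∧ mv = cr ω v + β ∧ mw = cr ω w + β := by
  obtain ⟨β, hu, hv, hw⟩ := exists_dt hd (dt mu u) (dt mv v) (dt mw w)
  refine ⟨(dd u v w)⁻¹ • (dt (mv - β) w • u + dt (mw - β) u • v + dt (mu - β) v • w), β, ?_, ?_, ?_⟩
  all_goals
    have key : ∀ a b : V3, ∀ r : ℝ, dt (cr (r • a) b) = fun c => r * dt (cr a b) c := by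
      intro a b r; funext c; simp [dt, cr0, cr1, cr2]; ring
    rw [← sub_eq_iff_eq_add]
    apply eq_of_dt hd <;> rw [key]
    all_goals
      rw [eq_comm, inv_mul_eq_iff_eq_mul₀ hd]
      simp only [dt, Pi.sub_apply] at h1 h2 h3 hu hv hw
      simp only [dd, dt, cr0, cr1, cr2, Pi.sub_apply, Pi.add_apply, Pi.smul_apply, smul_eq_mul]
      generalize hD : (u 1 * v 2 - u 2 * v 1) * w 0 + (u 2 * v 0 - u 0 * v 2) * w 1 +
        (u 0 * v 1 - u 1 * v 0) * w 2 = D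
  · linear_combination D * hu
  · rw [← hD]; ring
  · rw [← hD]
    linear_combination ((u 1 * v 2 - u 2 * v 1) * w 0 + (u 2 * v 0 - u 0 * v 2) * w 1 +
        (u 0 * v 1 - u 1 * v 0) * w 2) * (h3 + hu + hw)
  · rw [← hD]
    linear_combination ((u 1 * v 2 - u 2 * v 1) * w 0 + (u 2 * v 0 - u 0 * v 2) * w 1 +
        (u 0 * v 1 - u 1 * v 0) * w 2) * (h1 + hu + hv)
  · linear_combination D * hv
  · rw [← hD]; ring
  · rw [← hD]; ring
  · rw [← hD]
    linear_combination ((u 1 * v 2 - u 2 * v 1) * w 0 + (u 2 * v 0 - u 0 * v 2) * w 1 +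
        (u 0 * v 1 - u 1 * v 0) * w 2) * (h2 + hv + hw)
  · linear_combination D * hw

lemma generic {ι : Type} (s : Finset ι) (n : ι → V3) (hn : ∀ i ∈ s, n i ≠ 0) :
    ∃ e : V3, ∀ i ∈ s, dt (n i) e ≠ 0 := by
  obtain ⟨f, hf⟩ := Module.exists_dual_forall_apply_ne_zero (K := ℝ) (fun i : s => n i)
    (fun i => hn i i.2)
  refine ⟨fun i => f (Pi.single i 1), fun i hi => ?_⟩
  have := hf ⟨i, hi⟩
  have h2 : f (n i) = dt (n i) (fun i => f (Pi.single i 1)) := by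
    conv_lhs => rw [← Finset.univ_sum_single (n i)]
    rw [map_sum, Fin.sum_univ_three]
    simp only [dt]
    have : ∀ j, (Pi.single j (n i j) : V3) = n i j • Pi.single j 1 := by
      intro j; rw [← Pi.single_smul]; simp
    rw [this 0, this 1, this 2]; simp
  rw [← h2]; exact this

/-! ### Simplicial surfaces of convex type in three-space -/
structure Dehn (ι : Type) where
  F : Finset (Finset ι)
  P : ι → V3
  x : Finset ι → V3
  card3 : ∀ f ∈ F, f.card = 3
  ge : ∀ f ∈ F, ∀ g ∈ F, ∀ u ∈ g, -1 ≤ dt (x f) (P u)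
  eqiff : ∀ f ∈ F, ∀ g ∈ F, ∀ u ∈ g, (dt (x f) (P u) = -1 ↔ u ∈ f)
  det : ∀ f ∈ F, ∀ u ∈ f, ∀ v ∈ f, ∀ w ∈ f, u ≠ v → u ≠ w → v ≠ w → dd (P u) (P v) (P w) ≠ 0
  nbr : ∀ f ∈ F, ∀ w ∈ f, ∃ g ∈ F, w ∉ g ∧ f.erase w ⊆ g

namespace Dehn
variable {ι : Type} (S : Dehn ι)

def D (f : Finset ι) (u v : ι) : ℝ := dd (S.P u) (S.P v) (∑ w ∈ f, S.P w)
def sg (f : Finset ι) (u v : ι) : ℝ := S.D f u v / |S.D f u v|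
def Fe (u v : ι) : Finset (Finset ι) := S.F.filter fun f => u ∈ f ∧ v ∈ f
def Fv (v : ι) : Finset (Finset ι) := S.F.filter fun f => v ∈ f
def N (v : ι) : Finset ι := ((S.Fv v).biUnion id).erase v
def J (y : Finset ι → V3) (u v : ι) : V3 := ∑ f ∈ S.Fe u v, S.sg f u v • y f

lemma third {f : Finset ι} (hf : f ∈ S.F) {u v : ι} (hu : u ∈ f) (hv : v ∈ f) (huv : u ≠ v) :
    ∃ w ∈ f, u ≠ w ∧ v ≠ w ∧ f = {u, v, w} := by
  have h1 : ({u, v} : Finset ι) ⊆ f := by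
    intro a ha; simp at ha; rcases ha with rfl | rfl <;> assumption
  have h2 : (f \ {u, v}).card = 1 := by
    rw [card_sdiff_of_subset h1, S.card3 f hf, card_pair huv]
  obtain ⟨w, hw⟩ := card_eq_one.mp h2
  have h3 : w ∈ f \ {u, v} := by rw [hw]; simp
  simp at h3
  refine ⟨w, h3.1, fun h => h3.2.1 h.symm, fun h => h3.2.2 h.symm, ?_⟩
  have : f = {u, v} ∪ (f \ {u, v}) := by rw [union_sdiff_of_subset h1]
  rw [this, hw]; ext; simp

lemma D_eq {u v w : ι} (h1 : u ≠ v) (h2 : u ≠ w) (h3 : v ≠ w) :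
    S.D {u, v, w} u v = dd (S.P u) (S.P v) (S.P w) := by
  have : dd (S.P u) (S.P v) (∑ a ∈ ({u, v, w} : Finset ι), S.P a) =
      ∑ a ∈ ({u, v, w} : Finset ι), dd (S.P u) (S.P v) (S.P a) := by simp only [dd, dt_sum]
  rw [D, this, sum_insert (by simp [h1, h2]), sum_insert (by simp [h3]), sum_singleton,
    dd_self1, dd_self2]; ring

lemma D_ne {f : Finset ι} (hf : f ∈ S.F) {u v : ι} (hu : u ∈ f) (hv : v ∈ f) (huv : u ≠ v) :
    S.D f u v ≠ 0 := by
  obtain ⟨w, hw, h1, h2, rfl⟩ := S.third hf hu hv huv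
  rw [S.D_eq huv h1 h2]
  exact S.det _ hf u hu v hv w hw huv h1 h2

lemma D_swap (f : Finset ι) (u v : ι) : S.D f u v = - S.D f v u := dd_swap _ _ _

lemma sg_swap (f : Finset ι) (u v : ι) : S.sg f u v = - S.sg f v u := by
  rw [sg, sg, S.D_swap f u v, abs_neg, neg_div]

lemma sg_mul_self {f : Finset ι} {u v : ι} (h : S.D f u v ≠ 0) : S.sg f u v * S.sg f u v = 1 := by
  rw [sg, div_mul_div_comm, abs_mul_abs_self, div_self (mul_ne_zero h h)]

lemma sg_mul_D {f : Finset ι} {u v : ι} :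
    S.sg f u v * S.D f u v = |S.D f u v| := by
  rw [sg, div_mul_eq_mul_div, ← abs_mul_abs_self, mul_self_div_self]

lemma sg_other {u v w : ι} (h1 : v ≠ u) (h2 : v ≠ w) (h3 : u ≠ w) :
    S.sg {v, u, w} w v = - S.sg {v, u, w} u v := by
  have e1 : S.D {v, u, w} u v = dd (S.P u) (S.P v) (S.P w) := by
    rw [← S.D_eq h1.symm h3 h2]; congr 1; ext; simp; tauto
  have e2 : S.D {v, u, w} w v = - dd (S.P u) (S.P v) (S.P w) := by
    rw [← dd_swap, dd_cyc, dd_cyc, ← S.D_eq h2.symm h3.symm h1]; congr 1; ext; simp; tauto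
  rw [sg, sg, e1, e2, abs_neg, neg_div]

lemma D_opp {f g : Finset ι} (hf : f ∈ S.F) (hg : g ∈ S.F) (hfg : f ≠ g) {u v : ι}
    (huf : u ∈ f) (hvf : v ∈ f) (hug : u ∈ g) (hvg : v ∈ g) (huv : u ≠ v) :
    S.D f u v * S.D g u v < 0 := by
  obtain ⟨w, hw, h1, h2, hfe⟩ := S.third hf huf hvf huv
  obtain ⟨z, hz, h3, h4, hge⟩ := S.third hg hug hvg huv
  have hDf : S.D f u v = dd (S.P u) (S.P v) (S.P w) := by rw [hfe]; exact S.D_eq huv h1 h2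
  have hDg : S.D g u v = dd (S.P u) (S.P v) (S.P z) := by rw [hge]; exact S.D_eq huv h3 h4
  have hwz : w ≠ z := by rintro rfl; exact hfg (hfe.trans hge.symm)
  have hwg : w ∉ g := by rw [hge]; simp [h1.symm, h2.symm, hwz]
  have hzf : z ∉ f := by rw [hfe]; simp [h3.symm, h4.symm, hwz.symm]
  have hne := S.D_ne hf huf hvf huv
  rw [hDf] at hne
  have a1 := (S.eqiff f hf f hf u huf).2 huf
  have a2 := (S.eqiff f hf f hf v hvf).2 hvf
  have b1 := (S.eqiff g hg g hg u hug).2 hug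
  have b2 := (S.eqiff g hg g hg v hvg).2 hvg
  have a3 := (S.eqiff f hf f hf w hw).2 hw
  have b3 := (S.eqiff g hg g hg z hz).2 hz
  have a4 : -1 < dt (S.x f) (S.P z) := lt_of_le_of_ne (S.ge f hf g hg z hz)
    (fun h => hzf ((S.eqiff f hf g hg z hz).1 h.symm))
  have b4 : -1 < dt (S.x g) (S.P w) := lt_of_le_of_ne (S.ge g hg f hf w hw)
    (fun h => hwg ((S.eqiff g hg f hf w hw).1 h.symm))
  have hc := exists_mul_cr (y := S.x f - S.x g) hne (by rw [sub_dt]; linarith)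
    (by rw [sub_dt]; linarith)
  set c := dt (S.x f - S.x g) (S.P w) / dd (S.P u) (S.P v) (S.P w)
  have e1 : dt (S.x f - S.x g) (S.P w) = c * dd (S.P u) (S.P v) (S.P w) := by
    rw [hc, smul_dt]; rfl
  have e2 : dt (S.x f - S.x g) (S.P z) = c * dd (S.P u) (S.P v) (S.P z) := by
    rw [hc, smul_dt]; rfl
  rw [sub_dt] at e1 e2
  rw [hDf, hDg]
  have k1 : c * dd (S.P u) (S.P v) (S.P w) < 0 := by linarith
  have k2 : 0 < c * dd (S.P u) (S.P v) (S.P z) := by linarith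
  have : (c * dd (S.P u) (S.P v) (S.P w)) * (c * dd (S.P u) (S.P v) (S.P z)) < 0 :=
    mul_neg_of_neg_of_pos k1 k2
  by_contra hcon
  push Not at hcon
  nlinarith [mul_nonneg (mul_self_nonneg c) hcon]

lemma pair {f : Finset ι} (hf : f ∈ S.F) {u v : ι} (hu : u ∈ f) (hv : v ∈ f) (huv : u ≠ v) :
    ∃ g ∈ S.F, f ≠ g ∧ u ∈ g ∧ v ∈ g ∧ S.Fe u v = {f, g} := by
  obtain ⟨w, hw, h1, h2, hfe⟩ := S.third hf hu hv huv
  obtain ⟨g, hg, hwg, hsub⟩ := S.nbr f hf w hw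
  have hfg : f ≠ g := by rintro rfl; exact hwg hw
  have hug : u ∈ g := hsub (by simp [h1, hu])
  have hvg : v ∈ g := hsub (by simp [h2, hv])
  refine ⟨g, hg, hfg, hug, hvg, ?_⟩
  ext k
  simp only [Fe, mem_filter, mem_insert, mem_singleton]
  constructor
  · rintro ⟨hk, huk, hvk⟩
    by_contra hcon
    push Not at hcon
    have a1 := S.D_opp hf hg hfg hu hv hug hvg huv
    have a2 := S.D_opp hf hk hcon.1.symm hu hv huk hvk huv
    have a3 := S.D_opp hg hk hcon.2.symm hug hvg huk hvk huv
    nlinarith [mul_pos_of_neg_of_neg a1 a2, mul_self_nonneg (S.D f u v)]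
  · rintro (rfl | rfl)
    · exact ⟨hf, hu, hv⟩
    · exact ⟨hg, hug, hvg⟩

lemma sg_opp {f g : Finset ι} (hf : f ∈ S.F) (hg : g ∈ S.F) (hfg : f ≠ g) {u v : ι}
    (huf : u ∈ f) (hvf : v ∈ f) (hug : u ∈ g) (hvg : v ∈ g) (huv : u ≠ v) :
    S.sg g u v = - S.sg f u v := by
  have h := S.D_opp hf hg hfg huf hvf hug hvg huv
  unfold sg
  rcases mul_neg_iff.1 h with ⟨h1, h2⟩ | ⟨h1, h2⟩
  · rw [abs_of_pos h1, abs_of_neg h2, div_self h1.ne', div_neg, div_self h2.ne]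
  · rw [abs_of_neg h1, abs_of_pos h2, div_self h2.ne', div_neg, div_self h1.ne, neg_neg]

lemma J_eq {f g : Finset ι} (hf : f ∈ S.F) (hg : g ∈ S.F) (hfg : f ≠ g) {u v : ι}
    (huf : u ∈ f) (hvf : v ∈ f) (hug : u ∈ g) (hvg : v ∈ g) (huv : u ≠ v)
    (hFe : S.Fe u v = {f, g}) (y : Finset ι → V3) :
    S.J y u v = S.sg f u v • (y f - y g) := by
  rw [J, hFe, sum_pair hfg, S.sg_opp hf hg hfg huf hvf hug hvg huv]
  module

lemma J_swap (y : Finset ι → V3) (u v : ι) : S.J y u v = - S.J y v u := by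
  have : S.Fe u v = S.Fe v u := by unfold Fe; congr 1; ext; tauto
  rw [J, J, this, ← sum_neg_distrib]
  refine sum_congr rfl fun f _ => ?_
  rw [S.sg_swap f u v, neg_smul]

lemma mem_N {u v : ι} : u ∈ S.N v ↔ u ≠ v ∧ ∃ f ∈ S.F, u ∈ f ∧ v ∈ f := by
  simp only [N, Fv, mem_erase, mem_biUnion, mem_filter, id]
  constructor
  · rintro ⟨h, f, ⟨h1, h2⟩, h3⟩; exact ⟨h, f, h1, h3, h2⟩
  · rintro ⟨h, f, h1, h3, h2⟩; exact ⟨h, f, ⟨h1, h2⟩, h3⟩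

lemma swap {X : Type} [AddCommMonoid X] (v : ι) (G : ι → Finset ι → X) :
    ∑ u ∈ S.N v, ∑ f ∈ S.Fe u v, G u f = ∑ f ∈ S.Fv v, ∑ u ∈ f.erase v, G u f := by
  apply sum_comm'
  intro u f
  rw [S.mem_N]
  simp only [Fe, Fv, mem_filter, mem_erase]
  constructor
  · rintro ⟨⟨h, -⟩, h1, h2, h3⟩; exact ⟨⟨h, h2⟩, h1, h3⟩
  · rintro ⟨⟨h, h2⟩, h1, h3⟩; exact ⟨⟨h, f, h1, h2, h3⟩, h1, h2, h3⟩

lemma shape {f : Finset ι} {v : ι} (hf : f ∈ S.Fv v) :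
    ∃ u w, v ≠ u ∧ v ≠ w ∧ u ≠ w ∧ f = {v, u, w} ∧ f.erase v = {u, w} := by
  simp only [Fv, mem_filter] at hf
  have h2 : (f.erase v).card = 2 := by rw [card_erase_of_mem hf.2, S.card3 f hf.1]
  obtain ⟨u, w, huw, he⟩ := card_eq_two.1 h2
  have hu : u ∈ f.erase v := by rw [he]; simp
  have hw : w ∈ f.erase v := by rw [he]; simp
  refine ⟨u, w, (ne_of_mem_erase hu).symm, (ne_of_mem_erase hw).symm, huw, ?_, he⟩
  rw [← he, insert_erase hf.2]

lemma closing (v : ι) (y : Finset ι → V3) : ∑ u ∈ S.N v, S.J y u v = 0 := by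
  unfold J
  rw [S.swap v (fun u f => S.sg f u v • y f)]
  refine sum_eq_zero fun f hf => ?_
  obtain ⟨u, w, h1, h2, h3, rfl, he⟩ := S.shape hf
  rw [he, sum_pair h3, S.sg_other h1 h2 h3]
  module
end Dehn

lemma lines {κ : Type} (C : Finset κ) (a X B : κ → ℝ)
    (h : ∀ f ∈ C, ∀ g ∈ C, f ≠ g → a f * (X f - X g) < 0) :
    ∃ r s : ℝ, ∀ f ∈ C, B f + s * X f = r := by
  by_cases h1 : ∃ f ∈ C, ∃ g ∈ C, f ≠ g
  · obtain ⟨f, hf, g, hg, hfg⟩ := h1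
    have hX : X f - X g ≠ 0 := by
      intro h0; have := h f hf g hg hfg; rw [h0] at this; simp at this
    refine ⟨B f + (-(B f - B g) / (X f - X g)) * X f, -(B f - B g) / (X f - X g), ?_⟩
    intro k hk
    by_cases hkf : k = f
    · rw [hkf]
    by_cases hkg : k = g
    · rw [hkg]; field_simp; ring
    exfalso
    have a1 := h f hf g hg hfg
    have a2 := h g hg f hf hfg.symm
    have a3 := h k hk f hf hkf
    have a4 := h k hk g hg hkg
    have a5 := h f hf k hk (Ne.symm hkf)
    have a6 := h g hg k hk (Ne.symm hkg)
    rcases mul_neg_iff.1 a1 with ⟨b1, b2⟩ | ⟨b1, b2⟩ <;>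
    rcases mul_neg_iff.1 a2 with ⟨c1, c2⟩ | ⟨c1, c2⟩ <;>
    rcases mul_neg_iff.1 a3 with ⟨d1, d2⟩ | ⟨d1, d2⟩ <;>
    rcases mul_neg_iff.1 a4 with ⟨e1, e2⟩ | ⟨e1, e2⟩ <;>
    first
    | linarith
    | (rcases mul_neg_iff.1 a5 with ⟨f1, f2⟩ | ⟨f1, f2⟩ <;>
       rcases mul_neg_iff.1 a6 with ⟨g1, g2⟩ | ⟨g1, g2⟩ <;> linarith)
  · push Not at h1
    by_cases h2 : C.Nonempty
    · obtain ⟨f, hf⟩ := h2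
      exact ⟨B f, 0, fun g hg => by rw [h1 g hg f hf]; ring⟩
    · rw [not_nonempty_iff_eq_empty] at h2
      exact ⟨0, 0, by simp [h2]⟩

namespace Dehn
variable {ι : Type} (S : Dehn ι)

def W (v : ι) (e : V3) (f : Finset ι) : ℝ :=
  (1 / 2 * ∑ u ∈ f.erase v, |S.D f u v|) / ∏ u ∈ f.erase v, dd (S.P v) e (S.P u)

lemma mem_N_of {f : Finset ι} {u v : ι} (hf : f ∈ S.F) (hv : v ∈ f) (hu : u ∈ f) (h : v ≠ u) :
    u ∈ S.N v := S.mem_N.2 ⟨h.symm, f, hf, hu, hv⟩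

lemma bilin (v : ι) (e : V3) (ht : ∀ u ∈ S.N v, dd (S.P v) e (S.P u) ≠ 0)
    (y y' : Finset ι → V3) (k κ : ι → ℝ)
    (hy : ∀ f ∈ S.Fv v, dt (y f) (S.P v) = 0)
    (hk : ∀ f ∈ S.Fv v, ∀ u ∈ f.erase v, dt (y f) (S.P u) = k u)
    (hκ : ∀ u ∈ S.N v, S.J y' u v = -(κ u) • cr (S.P u) (S.P v)) :
    ∑ u ∈ S.N v, κ u * k u = ∑ f ∈ S.Fv v, S.W v e f * (dt (y' f) e * dt (y f) e) := by
  have step : ∀ u ∈ S.N v, κ u * k u = ∑ f ∈ S.Fe u v,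
      -(S.sg f u v * dt (y' f) e) * (dt (y f) (S.P u) / dd (S.P v) e (S.P u)) := by
    intro u hu
    have h1 : ∑ f ∈ S.Fe u v, S.sg f u v * dt (y' f) e = -(κ u) * dd (S.P v) e (S.P u) := by
      have := congrArg (fun z => dt z e) (hκ u hu)
      simp only [J, sum_dt, smul_dt] at this
      rw [this, ← dd_cyc]; rfl
    have h2 : ∀ f ∈ S.Fe u v, dt (y f) (S.P u) = k u := by
      intro f hf
      simp only [Fe, mem_filter] at hf
      exact hk f (by simp [Fv, hf]) u (by simp [hf, (S.mem_N.1 hu).1])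
    have h3 : ∑ f ∈ S.Fe u v,
      -(S.sg f u v * dt (y' f) e) * (dt (y f) (S.P u) / dd (S.P v) e (S.P u)) =
      -(∑ f ∈ S.Fe u v, S.sg f u v * dt (y' f) e) * (k u / dd (S.P v) e (S.P u)) := by
      rw [← sum_neg_distrib, sum_mul]
      exact sum_congr rfl fun f hf => by rw [h2 f hf]
    rw [h3, h1]
    have := ht u hu
    field_simp
  rw [sum_congr rfl step, S.swap v (fun u f =>
    -(S.sg f u v * dt (y' f) e) * (dt (y f) (S.P u) / dd (S.P v) e (S.P u)))]
  refine sum_congr rfl fun f hf => ?_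
  have hfF : f ∈ S.F := (mem_filter.1 hf).1
  have hvf : v ∈ f := (mem_filter.1 hf).2
  obtain ⟨u, w, h1, h2, h3, hfe, he⟩ := S.shape hf
  have huf : u ∈ f := by rw [hfe]; simp
  have hwf : w ∈ f := by rw [hfe]; simp
  have tu := ht u (S.mem_N_of hfF hvf huf h1)
  have tw := ht w (S.mem_N_of hfF hvf hwf h2)
  have hsg : S.sg f w v = - S.sg f u v := by
    have := S.sg_other h1 h2 h3; rw [← hfe] at this; exact this
  have hDu : S.D f u v = dd (S.P u) (S.P v) (S.P w) := by
    rw [← S.D_eq h1.symm h3 h2, hfe]; congr 1; ext; simp; tauto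
  have hDw : S.D f w v = dd (S.P w) (S.P v) (S.P u) := by
    rw [← S.D_eq h2.symm h3.symm h1, hfe]; congr 1; ext; simp; tauto
  have hab : |S.D f w v| = |S.D f u v| := by
    rw [hDu, hDw, dd_swap, abs_neg, dd_cyc, dd_cyc]
  have hid := four_id (S.P v) e (S.P u) (S.P w) (y f)
  rw [hy f hf] at hid
  have hD2 : dd (S.P v) (S.P u) (S.P w) = - S.D f u v := by rw [hDu, dd_swap]
  rw [hD2] at hid
  rw [W, he, sum_pair h3, sum_pair h3, prod_pair h3, hab, hsg, ← S.sg_mul_D]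
  field_simp
  linear_combination (-2 * S.sg f u v * dt (y' f) e) * hid

lemma W_sign {v : ι} {e : V3} {f : Finset ι} (hf : f ∈ S.Fv v)
    (h : 0 < ∏ u ∈ f.erase v, dd (S.P v) e (S.P u)) : 0 < S.W v e f := by
  unfold W
  refine div_pos ?_ h
  obtain ⟨u, w, h1, h2, h3, hfe, he⟩ := S.shape hf
  have hfF : f ∈ S.F := (mem_filter.1 hf).1
  have hvf : v ∈ f := (mem_filter.1 hf).2
  have huf : u ∈ f := by rw [hfe]; simp
  have hwf : w ∈ f := by rw [hfe]; simp
  rw [he, sum_pair h3]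
  have := abs_pos.2 (S.D_ne hfF huf hvf h1.symm)
  have := abs_pos.2 (S.D_ne hfF hwf hvf h2.symm)
  positivity

lemma crossing (v : ι) (e : V3) : ∃ a : Finset ι → ℝ,
    ∀ f ∈ (S.Fv v).filter (fun f => ∏ u ∈ f.erase v, dd (S.P v) e (S.P u) < 0),
    ∀ g ∈ (S.Fv v).filter (fun f => ∏ u ∈ f.erase v, dd (S.P v) e (S.P u) < 0), f ≠ g →
      a f * (dt (S.x f) e - dt (S.x g) e) < 0 := by
  have : ∀ f : Finset ι, ∃ a : ℝ,
    f ∈ (S.Fv v).filter (fun f => ∏ u ∈ f.erase v, dd (S.P v) e (S.P u) < 0) →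
    ∀ g ∈ (S.Fv v).filter (fun f => ∏ u ∈ f.erase v, dd (S.P v) e (S.P u) < 0), f ≠ g →
      a * (dt (S.x f) e - dt (S.x g) e) < 0 := by
    intro f
    by_cases hf : f ∈ (S.Fv v).filter (fun f => ∏ u ∈ f.erase v, dd (S.P v) e (S.P u) < 0)
    · obtain ⟨hf, hc⟩ := mem_filter.1 hf
      obtain ⟨u, w, h1, h2, h3, hfe, he⟩ := S.shape hf
      have hfF : f ∈ S.F := (mem_filter.1 hf).1
      have hvf : v ∈ f := (mem_filter.1 hf).2
      have huf : u ∈ f := by rw [hfe]; simp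
      have hwf : w ∈ f := by rw [hfe]; simp
      rw [he, prod_pair h3] at hc
      refine ⟨dd (S.P v) e (S.P w) * dd (S.P v) (S.P u) (S.P w), fun _ g hg hfg => ?_⟩
      have hgF : g ∈ S.F := (mem_filter.1 (mem_filter.1 hg).1).1
      have hvg : v ∈ g := (mem_filter.1 (mem_filter.1 hg).1).2
      have hid := four_id (S.P v) e (S.P u) (S.P w) (S.x f - S.x g)
      simp only [sub_dt] at hid
      rw [(S.eqiff f hfF f hfF v hvf).2 hvf, (S.eqiff f hfF f hfF u huf).2 huf,
        (S.eqiff f hfF f hfF w hwf).2 hwf, (S.eqiff g hgF g hgF v hvg).2 hvg] at hid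
      have k1 := S.ge g hgF f hfF u huf
      have k2 := S.ge g hgF f hfF w hwf
      have k3 : ¬ (dt (S.x g) (S.P u) = -1 ∧ dt (S.x g) (S.P w) = -1) := by
        rintro ⟨q1, q2⟩
        rw [S.eqiff g hgF f hfF u huf] at q1
        rw [S.eqiff g hgF f hfF w hwf] at q2
        apply hfg
        apply eq_of_subset_of_card_le
        · rw [hfe]; intro z hz; simp at hz; rcases hz with rfl | rfl | rfl <;> assumption
        · rw [S.card3 f hfF, S.card3 g hgF]
      have htw : 0 < dd (S.P v) e (S.P w) * dd (S.P v) e (S.P w) := by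
        apply mul_self_pos.2; intro h0; rw [h0] at hc; simp at hc
      have e1 : dd (S.P v) e (S.P w) * dd (S.P v) (S.P u) (S.P w) *
          (dt (S.x f) e - dt (S.x g) e) =
          (-1 - dt (S.x g) (S.P u)) * (dd (S.P v) e (S.P w) * dd (S.P v) e (S.P w)) -
          (-1 - dt (S.x g) (S.P w)) * (dd (S.P v) e (S.P u) * dd (S.P v) e (S.P w)) := by
        linear_combination (-dd (S.P v) e (S.P w)) * hid
      rw [e1]
      rcases k1.lt_or_eq with q1 | q1
      · nlinarith
      · rcases k2.lt_or_eq with q2 | q2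
        · rw [← q1]; nlinarith
        · exact absurd ⟨q1.symm, q2.symm⟩ k3
    · exact ⟨0, fun h => absurd h hf⟩
  choose a ha using this
  exact ⟨a, fun f hf g hg hfg => ha f hf g hg hfg⟩
end Dehn

namespace Dehn
variable {ι : Type} (S : Dehn ι)

lemma J_sub_const {u v : ι} (hu : u ∈ S.N v) (y : Finset ι → V3) (c : V3) :
    S.J (fun f => y f - c) u v = S.J y u v := by
  obtain ⟨huv, f, hf, huf, hvf⟩ := S.mem_N.1 hu
  obtain ⟨g, hg, hfg, hug, hvg, hFe⟩ := S.pair hf huf hvf huv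
  rw [S.J_eq hf hg hfg huf hvf hug hvg huv hFe, S.J_eq hf hg hfg huf hvf hug hvg huv hFe]
  module

lemma cr_ne {u v : ι} (hu : u ∈ S.N v) : cr (S.P u) (S.P v) ≠ 0 := by
  obtain ⟨huv, f, hf, huf, hvf⟩ := S.mem_N.1 hu
  intro h0
  apply S.D_ne hf huf hvf huv
  rw [D, dd, h0, zero_dt]

lemma ell {u v : ι} (hu : u ∈ S.N v) :
    ∃ l : ℝ, 0 < l ∧ S.J S.x u v = -l • cr (S.P u) (S.P v) := by
  obtain ⟨huv, f, hf, huf, hvf⟩ := S.mem_N.1 hu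
  obtain ⟨g, hg, hfg, hug, hvg, hFe⟩ := S.pair hf huf hvf huv
  obtain ⟨w, hw, h1, h2, hfe⟩ := S.third hf huf hvf huv
  have hDf : S.D f u v = dd (S.P u) (S.P v) (S.P w) := by rw [hfe]; exact S.D_eq huv h1 h2
  have hne := S.D_ne hf huf hvf huv
  have hwg : w ∉ g := by
    intro h
    apply hfg
    apply eq_of_subset_of_card_le
    · rw [hfe]; intro z hz; simp at hz; rcases hz with rfl | rfl | rfl <;> assumption
    · rw [S.card3 f hf, S.card3 g hg]
  have b4 : -1 < dt (S.x g) (S.P w) := lt_of_le_of_ne (S.ge g hg f hf w hw)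
    (fun h => hwg ((S.eqiff g hg f hf w hw).1 h.symm))
  have a1 := (S.eqiff f hf f hf u huf).2 huf
  have a2 := (S.eqiff f hf f hf v hvf).2 hvf
  have b1 := (S.eqiff g hg g hg u hug).2 hug
  have b2 := (S.eqiff g hg g hg v hvg).2 hvg
  have a3 := (S.eqiff f hf f hf w hw).2 hw
  have hc := exists_mul_cr (u := S.P u) (v := S.P v) (w := S.P w) (y := S.x f - S.x g)
    (by rw [← hDf]; exact hne) (by rw [sub_dt]; linarith) (by rw [sub_dt]; linarith)
  rw [← hDf] at hc
  refine ⟨-(dt (S.x f - S.x g) (S.P w)) / |S.D f u v|, ?_, ?_⟩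
  · apply div_pos
    · rw [sub_dt]; linarith
    · exact abs_pos.2 hne
  · rw [S.J_eq hf hg hfg huf hvf hug hvg huv hFe, hc, smul_smul, ← hc]
    congr 1
    rw [sg]; field_simp

lemma local_ineq (v : ι) (β : Finset ι → V3) (h lam : ι → ℝ)
    (hb : ∀ f ∈ S.Fv v, ∀ u ∈ f, dt (β f) (S.P u) = h u)
    (hJ : ∀ u ∈ S.N v, S.J β u v = -(lam u) • cr (S.P u) (S.P v))
    (hst : ∑ u ∈ S.N v, lam u • (S.P u - S.P v) = 0) :
    0 ≤ ∑ u ∈ S.N v, lam u * (h u - h v) ∧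
    (∑ u ∈ S.N v, lam u * (h u - h v) = 0 → ∀ u ∈ S.N v, lam u = 0) := by
  by_cases hN : (S.N v).Nonempty
  swap
  · rw [not_nonempty_iff_eq_empty] at hN; simp [hN]
  obtain ⟨u0, hu0⟩ := hN
  obtain ⟨huv0, f0, hf0F, huf0, hvf0⟩ := S.mem_N.1 hu0
  have hf0 : f0 ∈ S.Fv v := mem_filter.2 ⟨hf0F, hvf0⟩
  obtain ⟨e, he⟩ := generic (S.N v) (fun u => cr (S.P u) (S.P v)) (fun u hu => S.cr_ne hu)
  have ht : ∀ u ∈ S.N v, dd (S.P v) e (S.P u) ≠ 0 := by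
    intro u hu; rw [← dd_cyc]; exact he u hu
  obtain ⟨a, ha⟩ := S.crossing v e
  obtain ⟨r, s, hrs⟩ := lines _ a (fun f => dt (S.x f) e) (fun f => dt (β f) e) ha
  set ρ : ℝ := (r - dt (β f0) e - s * dt (S.x f0) e) / dt (cr (S.P u0) (S.P v)) e with hρ
  set ζ : V3 := β f0 + ρ • cr (S.P u0) (S.P v) with hζ
  have hζv : dt ζ (S.P v) = h v := by
    rw [hζ, add_dt, smul_dt, cr_dt_right, hb f0 hf0 v hvf0]; ring
  have hx0v : dt (S.x f0) (S.P v) = -1 := (S.eqiff f0 hf0F f0 hf0F v hvf0).2 hvf0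
  have hst' : ∀ z : V3, ∑ u ∈ S.N v, lam u * dt z (S.P u) = ∑ u ∈ S.N v, lam u * dt z (S.P v) := by
    intro z
    have := congrArg (dt z) hst
    rw [dt_sum, dt_zero] at this
    rw [← sub_eq_zero, ← sum_sub_distrib, ← this]
    exact sum_congr rfl fun u _ => by rw [dt_smul, dt_sub]; ring
  have hsub : ∀ f ∈ S.Fv v, f ∈ S.F ∧ v ∈ f := fun f hf => mem_filter.1 hf
  choose! l hl using fun u (hu : u ∈ S.N v) => S.ell hu
  have J1 : ∀ u ∈ S.N v, S.J (fun f => β f - ζ) u v = -(lam u) • cr (S.P u) (S.P v) := by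
    intro u hu; rw [S.J_sub_const hu, hJ u hu]
  have J2 : ∀ u ∈ S.N v, S.J (fun f => S.x f - S.x f0) u v = -(l u) • cr (S.P u) (S.P v) := by
    intro u hu; rw [S.J_sub_const hu, (hl u hu).2]
  have y1v : ∀ f ∈ S.Fv v, dt ((fun f => β f - ζ) f) (S.P v) = 0 := by
    intro f hf; simp only [sub_dt]; rw [hζv, hb f hf v (hsub f hf).2]; ring
  have y2v : ∀ f ∈ S.Fv v, dt ((fun f => S.x f - S.x f0) f) (S.P v) = 0 := by
    intro f hf; simp only [sub_dt]
    rw [hx0v, (S.eqiff f (hsub f hf).1 f (hsub f hf).1 v (hsub f hf).2).2 (hsub f hf).2]; ring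
  have y1k : ∀ f ∈ S.Fv v, ∀ u ∈ f.erase v, dt ((fun f => β f - ζ) f) (S.P u) =
      h u - dt ζ (S.P u) := by
    intro f hf u hu; simp only [sub_dt]; rw [hb f hf u (mem_of_mem_erase hu)]
  have y2k : ∀ f ∈ S.Fv v, ∀ u ∈ f.erase v, dt ((fun f => S.x f - S.x f0) f) (S.P u) =
      -1 - dt (S.x f0) (S.P u) := by
    intro f hf u hu; simp only [sub_dt]
    have hu := mem_of_mem_erase hu
    rw [(S.eqiff f (hsub f hf).1 f (hsub f hf).1 u hu).2 hu]
  have B11 := S.bilin v e ht _ _ _ _ y1v y1k J1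
  have B12 := S.bilin v e ht _ _ _ _ y2v y2k J1
  have B22 := S.bilin v e ht _ _ _ _ y2v y2k J2
  have C11 : ∑ u ∈ S.N v, lam u * (h u - dt ζ (S.P u)) = ∑ u ∈ S.N v, lam u * (h u - h v) := by
    simp only [mul_sub, sum_sub_distrib]; rw [hst' ζ, hζv]
  have C12 : ∑ u ∈ S.N v, lam u * (-1 - dt (S.x f0) (S.P u)) = 0 := by
    simp only [mul_sub, sum_sub_distrib]; rw [hst' (S.x f0), hx0v]; ring
  have C22 : ∑ u ∈ S.N v, l u * (-1 - dt (S.x f0) (S.P u)) < 0 := by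
    apply sum_neg'
    · intro u hu
      obtain ⟨-, f, hf, huf, -⟩ := S.mem_N.1 hu
      have := S.ge f0 hf0F f hf u huf
      have := (hl u hu).1
      nlinarith
    · obtain ⟨g, hg, hfg, hug, hvg, -⟩ := S.pair hf0F huf0 hvf0 huv0
      obtain ⟨w, hw, h1, h2, hge⟩ := S.third hg hug hvg huv0
      have hwN := S.mem_N_of hg hvg hw h2
      have hwf : w ∉ f0 := by
        intro h
        apply hfg
        symm
        apply eq_of_subset_of_card_le
        · rw [hge]; intro z hz; simp at hz; rcases hz with rfl | rfl | rfl <;> assumption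
        · rw [S.card3 f0 hf0F, S.card3 g hg]
      refine ⟨w, hwN, ?_⟩
      have b4 : -1 < dt (S.x f0) (S.P w) := lt_of_le_of_ne (S.ge f0 hf0F g hg w hw)
        (fun h => hwf ((S.eqiff f0 hf0F g hg w hw).1 h.symm))
      have := (hl w hwN).1
      nlinarith
  rw [C11] at B11
  rw [C12] at B12
  set A1 : Finset ι → ℝ := fun f => dt (β f - ζ) e with hA1
  set A2 : Finset ι → ℝ := fun f => dt (S.x f - S.x f0) e with hA2
  have key : ∑ f ∈ S.Fv v, S.W v e f * (A1 f + s * A2 f) ^ 2 =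
      ∑ u ∈ S.N v, lam u * (h u - h v) +
      s ^ 2 * ∑ u ∈ S.N v, l u * (-1 - dt (S.x f0) (S.P u)) := by
    rw [B11, B22]
    have : (0:ℝ) = 2 * s * ∑ f ∈ S.Fv v, S.W v e f * (A1 f * A2 f) := by
      rw [← B12]; ring
    rw [← add_zero (_ + _), this]
    simp only [mul_sum, ← sum_add_distrib]
    exact sum_congr rfl fun f _ => by ring
  have hprod : ∀ f ∈ S.Fv v, (∏ u ∈ f.erase v, dd (S.P v) e (S.P u)) ≠ 0 := by
    intro f hf
    rw [prod_ne_zero_iff]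
    intro u hu
    exact ht u (S.mem_N_of (hsub f hf).1 (hsub f hf).2 (mem_of_mem_erase hu)
      (ne_of_mem_erase hu).symm)
  have hcross : ∀ f ∈ S.Fv v, ∏ u ∈ f.erase v, dd (S.P v) e (S.P u) < 0 →
      A1 f + s * A2 f = 0 := by
    intro f hf hc
    have := hrs f (mem_filter.2 ⟨hf, hc⟩)
    have hr : ρ * dt (cr (S.P u0) (S.P v)) e = r - dt (β f0) e - s * dt (S.x f0) e := by
      rw [hρ, div_mul_cancel₀]; exact he u0 hu0
    simp only [hA1, hA2, hζ, sub_dt, add_dt, smul_dt]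
    rw [hr]
    linear_combination this
  have hterm : ∀ f ∈ S.Fv v, 0 ≤ S.W v e f * (A1 f + s * A2 f) ^ 2 := by
    intro f hf
    rcases lt_or_gt_of_ne (hprod f hf) with hc | hc
    · rw [hcross f hf hc]; simp
    · exact mul_nonneg (S.W_sign hf hc).le (sq_nonneg _)
  have hpos := sum_nonneg hterm
  rw [key] at hpos
  refine ⟨by nlinarith [sq_nonneg s], fun h0 => ?_⟩
  rw [h0] at hpos key
  have hs2 : s ^ 2 = 0 := by nlinarith [sq_nonneg s]
  have hs : s = 0 := by simpa using hs2
  rw [hs2] at key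
  simp only [zero_mul, add_zero] at key
  rw [sum_eq_zero_iff_of_nonneg hterm] at key
  have hA0 : ∀ f ∈ S.Fv v, A1 f = 0 := by
    intro f hf
    rcases lt_or_gt_of_ne (hprod f hf) with hc | hc
    · have := hcross f hf hc; rw [hs] at this; linarith
    · have h1 := key f hf
      have h2 := S.W_sign hf hc
      rcases mul_eq_zero.1 h1 with h3 | h3
      · exact absurd h3 h2.ne'
      · have := pow_eq_zero_iff (two_ne_zero) |>.1 h3
        rw [hs] at this; linarith
  intro u hu
  have h1 := congrArg (fun z => dt z e) (J1 u hu)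
  simp only [J, sum_dt, smul_dt] at h1
  rw [sum_eq_zero] at h1
  · have := he u hu
    have h2 : lam u * dt (cr (S.P u) (S.P v)) e = 0 := by linarith
    exact (mul_eq_zero.1 h2).resolve_right this
  · intro f hf
    have hf := mem_filter.1 hf
    have := hA0 f (mem_filter.2 ⟨hf.1, hf.2.2⟩)
    simp only [hA1] at this
    rw [this, mul_zero]

theorem main (m : ι → V3)
    (hm : ∀ f ∈ S.F, ∀ u ∈ f, ∀ v ∈ f, dt (S.P u - S.P v) (m u - m v) = 0)
    {f g : Finset ι} (hf : f ∈ S.F) (hg : g ∈ S.F) (hfg : f ≠ g) {u v : ι} (huv : u ≠ v)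
    (huf : u ∈ f) (hvf : v ∈ f) (hug : u ∈ g) (hvg : v ∈ g) (h0 : ∀ w ∈ f, m w = 0) :
    ∀ w ∈ g, m w = 0 := by
  have hex : ∀ f, ∃ ω β : V3, f ∈ S.F → ∀ u ∈ f, m u = cr ω (S.P u) + β := by
    intro f
    by_cases hf : f ∈ S.F
    · obtain ⟨u, v, w, h1, h2, h3, hfe⟩ := card_eq_three.1 (S.card3 f hf)
      have huf : u ∈ f := by rw [hfe]; simp
      have hvf : v ∈ f := by rw [hfe]; simp
      have hwf : w ∈ f := by rw [hfe]; simp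
      obtain ⟨ω, β, e1, e2, e3⟩ := triangle (S.det f hf u huf v hvf w hwf h1 h2 h3)
        (hm f hf u huf v hvf) (hm f hf v hvf w hwf) (hm f hf w hwf u huf)
      refine ⟨ω, β, fun _ z hz => ?_⟩
      rw [hfe] at hz; simp at hz
      rcases hz with rfl | rfl | rfl <;> assumption
    · exact ⟨0, 0, fun h => absurd h hf⟩
  choose ω β hωβ using hex
  set h : ι → ℝ := fun u => dt (m u) (S.P u) with hh
  have hb : ∀ f ∈ S.F, ∀ u ∈ f, dt (β f) (S.P u) = h u := by
    intro f hf u hu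
    simp only [hh]
    rw [hωβ f hf u hu, add_dt, cr_dt_right, zero_add]
  set lam : ι → ι → ℝ := fun u v =>
    dt (S.J ω u v) (S.P u - S.P v) / dt (S.P u - S.P v) (S.P u - S.P v) with hlam
  have lam_symm : ∀ u v, lam u v = lam v u := by
    intro u v
    simp only [hlam]
    rw [S.J_swap ω u v]
    congr 1 <;> (simp [dt]; ring)
  have edge : ∀ v, ∀ u ∈ S.N v, S.J ω u v = lam u v • (S.P u - S.P v) ∧
      S.J β u v = -(lam u v) • cr (S.P u) (S.P v) := by
    intro v u hu
    have hcn := S.cr_ne hu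
    obtain ⟨huv, f, hf, huf, hvf⟩ := S.mem_N.1 hu
    obtain ⟨g, hg, hfg, hug, hvg, hFe⟩ := S.pair hf huf hvf huv
    have hP : S.P u - S.P v ≠ 0 := by
      intro h; rw [sub_eq_zero] at h; apply hcn; rw [h]
      apply v3_ext <;> simp [cr0, cr1, cr2] <;> ring
    have a1 := (hωβ f hf u huf).symm.trans (hωβ g hg u hug)
    have a2 := (hωβ f hf v hvf).symm.trans (hωβ g hg v hvg)
    have hcz : cr (ω f - ω g) (S.P u - S.P v) = 0 := by
      have : cr (ω f - ω g) (S.P u - S.P v) =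
        ((cr (ω f) (S.P u) + β f) - (cr (ω g) (S.P u) + β g)) -
        ((cr (ω f) (S.P v) + β f) - (cr (ω g) (S.P v) + β g)) := by
        apply v3_ext <;> simp [cr0, cr1, cr2] <;> ring
      rw [this, a1, a2]; simp
    obtain ⟨c, hc⟩ := cr_eq_zero hP hcz
    have hβ : β f - β g = -c • cr (S.P u) (S.P v) := by
      have h1 : β f - β g = - cr (ω f - ω g) (S.P u) := by
        have : β f - β g = ((cr (ω f) (S.P u) + β f) - (cr (ω g) (S.P u) + β g)) -
          cr (ω f - ω g) (S.P u) := by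
          apply v3_ext <;> simp [cr0, cr1, cr2] <;> ring
        rw [this, a1]; simp
      rw [h1, hc]
      apply v3_ext <;> simp [cr0, cr1, cr2] <;> ring
    have e1 := S.J_eq hf hg hfg huf hvf hug hvg huv hFe ω
    have e2 := S.J_eq hf hg hfg huf hvf hug hvg huv hFe β
    rw [hc, smul_smul] at e1
    rw [hβ, smul_smul] at e2
    have e3 : lam u v = S.sg f u v * c := by
      simp only [hlam]
      rw [e1, smul_dt, mul_div_assoc, div_self (dt_self_pos hP).ne', mul_one]
    rw [e3]
    refine ⟨e1, ?_⟩
    rw [e2]; congr 1; ring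
  have loc := fun v => S.local_ineq v β h (fun u => lam u v)
    (fun f hf => hb f (mem_filter.1 hf).1) (fun u hu => (edge v u hu).2)
    (by rw [← S.closing v ω]; exact sum_congr rfl fun u hu => ((edge v u hu).1).symm)
  set U : Finset ι := S.F.biUnion id with hU
  have hNU : ∀ v, S.N v ⊆ U := by
    intro v u hu
    obtain ⟨huv, f, hf, huf, hvf⟩ := S.mem_N.1 hu
    exact mem_biUnion.2 ⟨f, hf, huf⟩
  have tot : ∑ v ∈ U, ∑ u ∈ S.N v, lam u v * (h u - h v) = 0 := by
    have e1 : ∑ v ∈ U, ∑ u ∈ S.N v, lam u v * (h u - h v) =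
        ∑ u ∈ U, ∑ v ∈ S.N u, lam u v * (h u - h v) := by
      apply sum_comm'
      intro v u
      constructor
      · rintro ⟨h1, h2⟩
        obtain ⟨huv, f, hf, huf, hvf⟩ := S.mem_N.1 h2
        exact ⟨S.mem_N.2 ⟨huv.symm, f, hf, hvf, huf⟩, hNU v h2⟩
      · rintro ⟨h2, h1⟩
        obtain ⟨huv, f, hf, huf, hvf⟩ := S.mem_N.1 h2
        exact ⟨hNU u h2, S.mem_N.2 ⟨huv.symm, f, hf, hvf, huf⟩⟩
    have e2 : ∑ u ∈ U, ∑ v ∈ S.N u, lam u v * (h u - h v) =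
        - ∑ v ∈ U, ∑ u ∈ S.N v, lam u v * (h u - h v) := by
      rw [← sum_neg_distrib]
      refine sum_congr rfl fun u _ => ?_
      rw [← sum_neg_distrib]
      refine sum_congr rfl fun v _ => ?_
      rw [lam_symm u v]; ring
    linarith
  rw [sum_eq_zero_iff_of_nonneg fun v _ => (loc v).1] at tot
  have huN : u ∈ S.N v := S.mem_N.2 ⟨huv, f, hf, huf, hvf⟩
  have hl0 : lam u v = 0 := (loc v).2 (tot v (mem_biUnion.2 ⟨f, hf, hvf⟩)) u huN
  obtain ⟨g', hg', hfg', hug', hvg', hFe⟩ := S.pair hf huf hvf huv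
  have hgg : g = g' := by
    have : g ∈ S.Fe u v := mem_filter.2 ⟨hg, hug, hvg⟩
    rw [hFe] at this; simp at this
    exact this.resolve_left hfg.symm
  subst hgg
  have hsg : S.sg f u v ≠ 0 := by
    intro h; have := S.sg_mul_self (S.D_ne hf huf hvf huv); rw [h] at this; simp at this
  have hw : ω f = ω g := by
    have := (edge v u huN).1
    rw [S.J_eq hf hg hfg huf hvf hug hvg huv hFe, hl0, zero_smul, smul_eq_zero] at this
    exact sub_eq_zero.1 (this.resolve_left hsg)
  have hbb : β f = β g := by
    have := (edge v u huN).2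
    rw [S.J_eq hf hg hfg huf hvf hug hvg huv hFe, hl0, neg_zero, zero_smul, smul_eq_zero] at this
    exact sub_eq_zero.1 (this.resolve_left hsg)
  obtain ⟨z, hz, h1, h2, hfe⟩ := S.third hf huf hvf huv
  have hdet := S.det f hf u huf v hvf z hz huv h1 h2
  have hβ0 : β f = 0 := by
    apply eq_zero_of_dt hdet
    · rw [hb f hf u huf]; simp [hh, h0 u huf, zero_dt]
    · rw [hb f hf v hvf]; simp [hh, h0 v hvf, zero_dt]
    · rw [hb f hf z hz]; simp [hh, h0 z hz, zero_dt]
  have hc : ∀ w ∈ f, cr (ω f) (S.P w) = 0 := by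
    intro w hw
    have := hωβ f hf w hw
    rw [h0 w hw, hβ0, add_zero] at this
    exact this.symm
  have hω0 : ω f = 0 := by
    have hPu : S.P u ≠ 0 := by
      intro h; apply hdet; rw [h]; simp [dd, dt, cr0, cr1, cr2]
    obtain ⟨c, hcu⟩ := cr_eq_zero hPu (hc u huf)
    have h3 := hc v hvf
    rw [hcu] at h3
    have h4 : c * dd (S.P u) (S.P v) (S.P z) = 0 := by
      have := congrArg (fun y => dt y (S.P z)) h3
      simp only [zero_dt] at this
      rw [← this]; simp [dd, dt, cr0, cr1, cr2]; ring
    have : c = 0 := (mul_eq_zero.1 h4).resolve_right hdet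
    rw [hcu, this, zero_smul]
  intro w hwg
  rw [hωβ g hg w hwg, ← hw, ← hbb, hω0, hβ0]
  apply v3_ext <;> simp [cr0, cr1, cr2]
end Dehn

/-! ### Simplicial cones -/

structure PC (ι E : Type) [AddCommGroup E] [Module ℝ E] (d : ℕ) where
  V : Finset ι
  p : ι → E
  fr : Module.finrank ℝ E = d + 1
  span : ∀ φ : E →ₗ[ℝ] ℝ, (∀ v ∈ V, φ (p v) = 0) → φ = 0
  ind : ∀ φ : E →ₗ[ℝ] ℝ, φ ≠ 0 → (∀ v ∈ V, 0 ≤ φ (p v)) →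
    LinearIndepOn ℝ p {v | v ∈ V ∧ φ (p v) = 0}

lemma interp {ι E : Type} [AddCommGroup E] [Module ℝ E] {p : ι → E} {s : Set ι}
    (h : LinearIndepOn ℝ p s) (a : ι → ℝ) : ∃ χ : E →ₗ[ℝ] ℝ, ∀ v ∈ s, χ (p v) = a v := by
  have h' : LinearIndependent ℝ (fun x : s => p x) := h
  obtain ⟨χ, hχ⟩ := LinearMap.exists_extend ((Module.Basis.span h').constr ℝ (fun x : s => a x))
  refine ⟨χ, fun v hv => ?_⟩
  have h1 := (Module.Basis.span h').constr_basis ℝ (fun x : s => a x) ⟨v, hv⟩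
  rw [← hχ] at h1
  simpa [Module.Basis.span_apply] using h1

namespace PC
variable {ι E : Type} [AddCommGroup E] [Module ℝ E] [FiniteDimensional ℝ E] {d : ℕ}
  (C : PC ι E d)

def Z (φ : E →ₗ[ℝ] ℝ) : Finset ι := C.V.filter fun v => φ (C.p v) = 0
def o : E := ∑ v ∈ C.V, C.p v
def NN (φ : E →ₗ[ℝ] ℝ) : Prop := ∀ v ∈ C.V, 0 ≤ φ (C.p v)

lemma mem_Z {φ : E →ₗ[ℝ] ℝ} {v : ι} : v ∈ C.Z φ ↔ v ∈ C.V ∧ φ (C.p v) = 0 := by simp [Z]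

lemma indZ {φ : E →ₗ[ℝ] ℝ} (h0 : φ ≠ 0) (h : C.NN φ) : LinearIndepOn ℝ C.p (C.Z φ : Set ι) := by
  have := C.ind φ h0 h
  convert this using 1
  ext v; simp [Z]

lemma pos_o {φ : E →ₗ[ℝ] ℝ} (h0 : φ ≠ 0) (h : C.NN φ) : 0 < φ C.o := by
  rw [o, map_sum]
  refine lt_of_le_of_ne (sum_nonneg h) fun he => h0 (C.span φ ?_)
  exact (sum_eq_zero_iff_of_nonneg h).1 he.symm

lemma ann_rank {s : Finset ι} (h : LinearIndepOn ℝ C.p (s : Set ι)) :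
    s.card + Module.finrank ℝ (Submodule.span ℝ (C.p '' (s : Set ι))).dualAnnihilator = d + 1 := by
  have h' : LinearIndependent ℝ (fun x : s => C.p x) := h
  have h1 := finrank_span_eq_card h'
  have h2 := Subspace.finrank_add_finrank_dualAnnihilator_eq
    (Submodule.span ℝ (C.p '' (s : Set ι)))
  rw [C.fr] at h2
  rw [← h2]
  congr 1
  rw [Fintype.card_coe] at h1
  rw [← h1]
  have : C.p '' (s : Set ι) = Set.range (fun x : s => C.p x) := by ext x; simp
  rw [this]

lemma mem_ann {s : Finset ι} {χ : E →ₗ[ℝ] ℝ} :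
    χ ∈ (Submodule.span ℝ (C.p '' (s : Set ι))).dualAnnihilator ↔ ∀ v ∈ s, χ (C.p v) = 0 := by
  rw [Submodule.mem_dualAnnihilator]
  constructor
  · intro h v hv
    exact h _ (Submodule.subset_span ⟨v, hv, rfl⟩)
  · intro h w hw
    have : Submodule.span ℝ (C.p '' (s : Set ι)) ≤ LinearMap.ker χ := by
      rw [Submodule.span_le]
      rintro _ ⟨v, hv, rfl⟩
      exact h v hv
    exact this hw

lemma card_le {s : Finset ι} (h : LinearIndepOn ℝ C.p (s : Set ι)) {φ : E →ₗ[ℝ] ℝ} (h0 : φ ≠ 0)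
    (hs : ∀ v ∈ s, φ (C.p v) = 0) : s.card ≤ d := by
  have h1 := C.ann_rank h
  have : 0 < Module.finrank ℝ (Submodule.span ℝ (C.p '' (s : Set ι))).dualAnnihilator := by
    exact (Module.finrank_pos_iff_exists_ne_zero (R := ℝ)).2
      ⟨⟨φ, C.mem_ann.2 hs⟩, fun h => h0 (congrArg Subtype.val h)⟩
  omega

lemma unique_ann {s : Finset ι} (h : LinearIndepOn ℝ C.p (s : Set ι)) (hc : s.card = d)
    {φ χ : E →ₗ[ℝ] ℝ} (h0 : φ ≠ 0) (hs : ∀ v ∈ s, φ (C.p v) = 0) (hs' : ∀ v ∈ s, χ (C.p v) = 0) :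
    ∃ c : ℝ, χ = c • φ := by
  have h1 := C.ann_rank h
  have h2 : Module.finrank ℝ (Submodule.span ℝ (C.p '' (s : Set ι))).dualAnnihilator = 1 := by omega
  obtain ⟨c, hc⟩ := (finrank_eq_one_iff_of_nonzero' 
    (⟨φ, C.mem_ann.2 hs⟩ : (Submodule.span ℝ (C.p '' (s : Set ι))).dualAnnihilator)
    (fun h => h0 (congrArg Subtype.val h))).1 h2 ⟨χ, C.mem_ann.2 hs'⟩
  exact ⟨c, (congrArg Subtype.val hc).symm⟩

lemma exists_ann {s : Finset ι} (h : LinearIndepOn ℝ C.p (s : Set ι)) (hc : s.card < d)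
    {φ : E →ₗ[ℝ] ℝ} (hs : ∀ v ∈ s, φ (C.p v) = 0) :
    ∃ χ : E →ₗ[ℝ] ℝ, (∀ v ∈ s, χ (C.p v) = 0) ∧ ∀ c : ℝ, χ ≠ c • φ := by
  have h1 := C.ann_rank h
  by_contra hne
  push Not at hne
  have := finrank_le_one 
    (⟨φ, C.mem_ann.2 hs⟩ : (Submodule.span ℝ (C.p '' (s : Set ι))).dualAnnihilator) (by
      rintro ⟨χ, hχ⟩
      obtain ⟨c, hc⟩ := hne χ (C.mem_ann.1 hχ)
      exact ⟨c, Subtype.ext hc.symm⟩)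
  omega

/-- Pushing a nonnegative functional in direction `χ` until a new zero appears. -/
lemma push {φ χ : E →ₗ[ℝ] ℝ} (h : C.NN φ) (hz : ∀ v ∈ C.Z φ, 0 ≤ χ (C.p v))
    (hneg : ∃ u ∈ C.V, χ (C.p u) < 0) :
    ∃ t : ℝ, 0 < t ∧ C.NN (t • φ + χ) ∧ ∃ u ∈ C.V, u ∉ C.Z φ ∧ (t • φ + χ) (C.p u) = 0 := by
  set S := C.V.filter fun u => χ (C.p u) < 0 with hS
  have hSn : S.Nonempty := by
    obtain ⟨u, hu, h1⟩ := hneg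
    exact ⟨u, mem_filter.2 ⟨hu, h1⟩⟩
  obtain ⟨u0, hu0, hmax⟩ := exists_max_image S (fun u => - χ (C.p u) / φ (C.p u)) hSn
  have hφ : ∀ u ∈ S, 0 < φ (C.p u) := by
    intro u hu
    obtain ⟨h1, h2⟩ := mem_filter.1 hu
    refine lt_of_le_of_ne (h u h1) fun he => ?_
    exact absurd (hz u (C.mem_Z.2 ⟨h1, he.symm⟩)) (not_le.2 h2)
  have hu0V := (mem_filter.1 hu0).1
  have hu0n := (mem_filter.1 hu0).2
  have ht : 0 < - χ (C.p u0) / φ (C.p u0) := div_pos (by linarith) (hφ u0 hu0)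
  refine ⟨_, ht, ?_, u0, hu0V, ?_, ?_⟩
  · intro v hv
    simp only [LinearMap.add_apply, LinearMap.smul_apply, smul_eq_mul]
    by_cases hvS : v ∈ S
    · have := hmax v hvS
      rw [div_le_iff₀ (hφ v hvS)] at this
      linarith
    · have h1 : 0 ≤ χ (C.p v) := by
        by_contra h1; exact hvS (mem_filter.2 ⟨hv, not_le.1 h1⟩)
      have := mul_nonneg ht.le (h v hv)
      linarith
  · intro hh
    have := (C.mem_Z.1 hh).2
    exact (hφ u0 hu0).ne' this
  · simp only [LinearMap.add_apply, LinearMap.smul_apply, smul_eq_mul]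
    rw [div_mul_cancel₀ _ (hφ u0 hu0).ne']; ring

def IsFct (f : Finset ι) : Prop :=
  ∃ φ : E →ₗ[ℝ] ℝ, C.NN φ ∧ φ C.o = 1 ∧ C.Z φ = f ∧ f.card = d

def phi (f : Finset ι) : E →ₗ[ℝ] ℝ := if h : C.IsFct f then h.choose else 0

section
variable {C}
lemma IsFct.spec {f : Finset ι} (h : C.IsFct f) :
    C.NN (C.phi f) ∧ C.phi f C.o = 1 ∧ C.Z (C.phi f) = f ∧ f.card = d := by
  rw [phi, dif_pos h]; exact h.choose_spec
lemma IsFct.nn {f : Finset ι} (h : C.IsFct f) : C.NN (C.phi f) := h.spec.1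
lemma IsFct.phi_o {f : Finset ι} (h : C.IsFct f) : C.phi f C.o = 1 := h.spec.2.1
lemma IsFct.card {f : Finset ι} (h : C.IsFct f) : f.card = d := h.spec.2.2.2
lemma IsFct.sub {f : Finset ι} (h : C.IsFct f) : f ⊆ C.V := by
  intro v hv; rw [← h.spec.2.2.1] at hv; exact (C.mem_Z.1 hv).1
lemma IsFct.zero {f : Finset ι} (h : C.IsFct f) {v : ι} (hv : v ∈ f) : C.phi f (C.p v) = 0 := by
  rw [← h.spec.2.2.1] at hv; exact (C.mem_Z.1 hv).2
lemma IsFct.mem {f : Finset ι} (h : C.IsFct f) {v : ι} (hv : v ∈ C.V)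
    (h0 : C.phi f (C.p v) = 0) : v ∈ f := by
  rw [← h.spec.2.2.1]; exact C.mem_Z.2 ⟨hv, h0⟩
lemma IsFct.pos {f : Finset ι} (h : C.IsFct f) {v : ι} (hv : v ∈ C.V) (hf : v ∉ f) :
    0 < C.phi f (C.p v) :=
  lt_of_le_of_ne (h.nn v hv) fun he => hf (h.mem hv he.symm)
lemma IsFct.ne {f : Finset ι} (h : C.IsFct f) : C.phi f ≠ 0 := by
  intro h0; have := h.phi_o; rw [h0] at this; simp at this
lemma IsFct.ind {f : Finset ι} (h : C.IsFct f) : LinearIndepOn ℝ C.p (f : Set ι) := by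
  have := C.indZ h.ne h.nn
  rwa [h.spec.2.2.1] at this
lemma IsFct.K1 {f : Finset ι} (h : C.IsFct f) {χ : E →ₗ[ℝ] ℝ} (h1 : ∀ v ∈ f, χ (C.p v) = 0)
    (h2 : χ C.o = 0) : χ = 0 := by
  obtain ⟨c, hc⟩ := C.unique_ann h.ind h.card h.ne (fun v hv => h.zero hv) h1
  rw [hc] at h2
  simp [h.phi_o] at h2
  rw [hc, h2, zero_smul]
lemma IsFct.K2 {f : Finset ι} (h : C.IsFct f) (a : ι → ℝ) (b : ℝ) :
    ∃ χ : E →ₗ[ℝ] ℝ, (∀ v ∈ f, χ (C.p v) = a v) ∧ χ C.o = b := by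
  obtain ⟨χ, hχ⟩ := interp h.ind a
  refine ⟨χ + (b - χ C.o) • C.phi f, fun v hv => ?_, ?_⟩
  · simp [h.zero hv, hχ v hv]
  · simp [h.phi_o]
end

lemma mkFct {φ : E →ₗ[ℝ] ℝ} (h0 : φ ≠ 0) (h : C.NN φ) (hc : d ≤ (C.Z φ).card) :
    C.IsFct (C.Z φ) := by
  have hp := C.pos_o h0 h
  refine ⟨(φ C.o)⁻¹ • φ, ?_, ?_, ?_, ?_⟩
  · intro v hv
    exact mul_nonneg (inv_nonneg.2 hp.le) (h v hv)
  · simp [hp.ne']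
  · ext v; simp [mem_Z, hp.ne']
  · exact le_antisymm (C.card_le (C.indZ h0 h) h0 fun v hv => (C.mem_Z.1 hv).2) hc

/-- Every face is contained in a facet. -/
lemma exists_fct {φ : E →ₗ[ℝ] ℝ} (h0 : φ ≠ 0) (h : C.NN φ) : ∃ f, C.IsFct f ∧ C.Z φ ⊆ f := by
  by_cases hc : d ≤ (C.Z φ).card
  · exact ⟨_, C.mkFct h0 h hc, Subset.rfl⟩
  push Not at hc
  obtain ⟨χ, hχ, hind⟩ := C.exists_ann (C.indZ h0 h) hc fun v hv => (C.mem_Z.1 hv).2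
  have key : ∃ χ : E →ₗ[ℝ] ℝ, (∀ v ∈ C.Z φ, χ (C.p v) = 0) ∧ (∀ c : ℝ, χ ≠ c • φ) ∧
      ∃ u ∈ C.V, χ (C.p u) < 0 := by
    by_cases hn : ∃ u ∈ C.V, χ (C.p u) < 0
    · exact ⟨χ, hχ, hind, hn⟩
    · push Not at hn
      refine ⟨-χ, fun v hv => by simp [hχ v hv], fun c hcc => hind (-c) ?_, ?_⟩
      · ext x
        have := LinearMap.congr_fun hcc x
        simp at this ⊢; linarith
      · by_contra hn'
        push Not at hn'
        apply hind 0
        rw [zero_smul]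
        refine C.span χ fun v hv => ?_
        have := hn' v hv
        simp at this
        exact le_antisymm this (hn v hv)
  obtain ⟨χ, hχ, hind, hneg⟩ := key
  obtain ⟨t, ht, hnn, u, hu, huZ, hu0⟩ := C.push h (fun v hv => (hχ v hv).ge) hneg
  have hne : t • φ + χ ≠ 0 := by
    intro hh
    apply hind (-t)
    ext x
    have := LinearMap.congr_fun hh x
    simp at this ⊢; linarith
  have hsub : C.Z φ ⊂ C.Z (t • φ + χ) := by
    refine (Finset.ssubset_iff_of_subset ?_).2 ⟨u, C.mem_Z.2 ⟨hu, hu0⟩, huZ⟩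
    intro v hv
    exact C.mem_Z.2 ⟨(C.mem_Z.1 hv).1, by simp [hχ v hv, (C.mem_Z.1 hv).2]⟩
  have hlt := card_lt_card hsub
  obtain ⟨f, hf, hsf⟩ := exists_fct hne hnn
  exact ⟨f, hf, hsub.subset.trans hsf⟩
termination_by d - (C.Z φ).card

/-- Pivoting. -/
lemma pivot {f : Finset ι} (h : C.IsFct f) {v : ι} (hv : v ∈ f) :
    ∃ g, C.IsFct g ∧ v ∉ g ∧ f.erase v ⊆ g := by
  obtain ⟨χ, hχ, hχo⟩ := h.K2 (fun u => if u = v then 1 else 0) (-1)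
  have hneg : ∃ u ∈ C.V, χ (C.p u) < 0 := by
    by_contra hn
    push Not at hn
    have : 0 ≤ χ C.o := by rw [o, map_sum]; exact sum_nonneg hn
    linarith
  have hZ : C.Z (C.phi f) = f := h.spec.2.2.1
  obtain ⟨t, ht, hnn, u, hu, huZ, hu0⟩ := C.push h.nn (χ := χ) (by
    rw [hZ]; intro w hw; rw [hχ w hw]; split_ifs <;> simp) hneg
  rw [hZ] at huZ
  have hv1 : (t • C.phi f + χ) (C.p v) = 1 := by simp [h.zero hv, hχ v hv]
  have hne : t • C.phi f + χ ≠ 0 := by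
    intro hh; rw [hh] at hv1; simp at hv1
  have hsub : insert u (f.erase v) ⊆ C.Z (t • C.phi f + χ) := by
    intro w hw
    rcases mem_insert.1 hw with rfl | hw
    · exact C.mem_Z.2 ⟨hu, hu0⟩
    · obtain ⟨h1, h2⟩ := mem_erase.1 hw
      exact C.mem_Z.2 ⟨h.sub h2, by simp [h.zero h2, hχ w h2, h1]⟩
  refine ⟨C.Z (t • C.phi f + χ), C.mkFct hne hnn ?_, ?_, (subset_insert _ _).trans hsub⟩
  · have := card_le_card hsub
    rw [card_insert_of_notMem (fun hh => huZ (mem_of_mem_erase hh)), card_erase_of_mem hv,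
      h.card] at this
    have : 0 < d := by rw [← h.card]; exact card_pos.2 ⟨v, hv⟩
    omega
  · intro hh
    have := (C.mem_Z.1 hh).2
    rw [hv1] at this; simp at this

/-- Dual basis attached to a facet. -/
lemma dual {f : Finset ι} (h : C.IsFct f) : ∃ χ : ι → E →ₗ[ℝ] ℝ,
    (∀ v ∈ f, ∀ u ∈ f, χ v (C.p u) = if u = v then 1 else 0) ∧ (∀ v ∈ f, χ v C.o = 0) ∧
    (∀ ψ : E →ₗ[ℝ] ℝ, ψ = ∑ v ∈ f, ψ (C.p v) • χ v + ψ C.o • C.phi f) ∧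
    (∀ x : E, x = ∑ v ∈ f, χ v x • C.p v + C.phi f x • C.o) := by
  choose χ h1 h2 using fun v : ι => h.K2 (fun u => if u = v then 1 else 0) 0
  have h3 : ∀ ψ : E →ₗ[ℝ] ℝ, ψ = ∑ v ∈ f, ψ (C.p v) • χ v + ψ C.o • C.phi f := by
    intro ψ
    rw [← sub_eq_zero]
    apply h.K1
    · intro u hu
      simp only [LinearMap.sub_apply, LinearMap.add_apply, LinearMap.sum_apply,
        LinearMap.smul_apply, smul_eq_mul, h.zero hu, h1 _ u hu]
      simp [hu]
    · simp [h2, h.phi_o, LinearMap.sum_apply]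
  refine ⟨χ, fun v _ u hu => h1 v u hu, fun v _ => h2 v, h3, fun x => ?_⟩
  rw [← sub_eq_zero, ← Module.forall_dual_apply_eq_zero_iff ℝ]
  intro ψ
  have := LinearMap.congr_fun (h3 ψ) x
  simp only [LinearMap.add_apply, LinearMap.sum_apply, LinearMap.smul_apply, smul_eq_mul] at this
  rw [map_sub, map_add, map_sum]
  simp only [map_smul, smul_eq_mul]
  rw [sub_eq_zero, this]
  congr 1
  · exact sum_congr rfl fun _ _ => mul_comm _ _
  · exact mul_comm _ _

lemma eq_of_sub {f g : Finset ι} (hf : C.IsFct f) (hg : C.IsFct g) (h : g ⊆ f) : g = f :=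
  eq_of_subset_of_card_le h (by rw [hf.card, hg.card])

lemma descent {σ f g : Finset ι} (hf : C.IsFct f) (hg : C.IsFct g) (hσf : σ ⊆ f) (hσg : σ ⊆ g)
    (hne : f ≠ g) : ∃ f', C.IsFct f' ∧ σ ⊆ f' ∧ (∃ v ∈ f, v ∉ f' ∧ f.erase v ⊆ f') ∧
      C.phi f' (∑ v ∈ g, C.p v) < C.phi f (∑ v ∈ g, C.p v) := by
  obtain ⟨χ, h1, h2, h3, -⟩ := C.dual hf
  set x := ∑ v ∈ g, C.p v with hx
  have hpos : 0 < C.phi f x := by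
    rw [hx, map_sum]
    have : ∃ v ∈ g, v ∉ f := by
      by_contra hh; push Not at hh
      exact hne (C.eq_of_sub hf hg hh).symm
    obtain ⟨v, hv, hvf⟩ := this
    exact sum_pos' (fun u hu => hf.nn u (hg.sub hu)) ⟨v, hv, hf.pos (hg.sub hv) hvf⟩
  have hgx : C.phi g x = 0 := by
    rw [hx, map_sum]; exact sum_eq_zero fun v hv => hg.zero hv
  have := LinearMap.congr_fun (h3 (C.phi g)) x
  simp only [LinearMap.add_apply, LinearMap.sum_apply, LinearMap.smul_apply, smul_eq_mul, hgx,
    hg.phi_o, one_mul] at this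
  have hex : ∃ v ∈ f, C.phi g (C.p v) * χ v x < 0 := by
    by_contra hh; push Not at hh
    have := sum_nonneg hh
    linarith
  obtain ⟨v, hv, hlt⟩ := hex
  have hg0 := hg.nn v (hf.sub hv)
  have ha : χ v x < 0 := by
    by_contra hh; push Not at hh
    exact absurd (mul_nonneg hg0 hh) (not_le.2 hlt)
  have hvg : v ∉ g := by
    intro hh; rw [hg.zero hh] at hlt; simp at hlt
  obtain ⟨f', hf', hvf', hsub⟩ := C.pivot hf hv
  refine ⟨f', hf', ?_, ⟨v, hv, hvf', hsub⟩, ?_⟩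
  · intro w hw
    exact hsub (mem_erase.2 ⟨fun hh => hvg (hh ▸ hσg hw), hσf hw⟩)
  · have e := LinearMap.congr_fun (h3 (C.phi f')) x
    rw [← add_sum_erase _ _ hv, sum_eq_zero (s := f.erase v)] at e
    · simp only [LinearMap.add_apply, LinearMap.smul_apply, smul_eq_mul, hf'.phi_o,
        one_mul, LinearMap.zero_apply, add_zero] at e
      rw [e]
      have := mul_neg_of_pos_of_neg (hf'.pos (hf.sub hv) hvf') ha
      linarith
    · intro u hu
      rw [hf'.zero (hsub hu), zero_smul]

theorem conn {σ g : Finset ι} (Q : Finset ι → Prop) (hg : C.IsFct g) (hσg : σ ⊆ g)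
    (step : ∀ f f', C.IsFct f → C.IsFct f' → σ ⊆ f → σ ⊆ f' →
      (∃ v ∈ f, v ∉ f' ∧ f.erase v ⊆ f') → Q f → Q f') :
    ∀ f, C.IsFct f → σ ⊆ f → Q f → Q g := by
  set N : Finset ι → ℕ := fun f => (C.V.powerset.filter fun h => C.IsFct h ∧
    C.phi h (∑ v ∈ g, C.p v) < C.phi f (∑ v ∈ g, C.p v)).card with hN
  have main : ∀ n f, N f = n → C.IsFct f → σ ⊆ f → Q f → Q g := by
    intro n
    induction n using Nat.strong_induction_on with
    | _ n ih =>
      intro f hn hf hσ hQ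
      by_cases hne : f = g
      · rwa [← hne]
      obtain ⟨f', hf', hσ', hv, hlt⟩ := C.descent hf hg hσ hσg hne
      refine ih (N f') ?_ f' rfl hf' hσ' (step f f' hf hf' hσ hσ' hv hQ)
      rw [← hn]
      apply card_lt_card
      refine (Finset.ssubset_iff_of_subset ?_).2 ⟨f', ?_, ?_⟩
      · intro h hh
        rw [mem_filter] at hh ⊢
        exact ⟨hh.1, hh.2.1, hh.2.2.trans hlt⟩
      · rw [mem_filter]; exact ⟨mem_powerset.2 hf'.sub, hf', hlt⟩
      · rw [mem_filter]; rintro ⟨_, _, h⟩; exact lt_irrefl _ h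
  exact fun f => main _ f rfl

/-- A skew form extending a motion of a facet. -/
lemma skew {f : Finset ι} (hf : C.IsFct f) (m : ι → E →ₗ[ℝ] ℝ)
    (h : ∀ u ∈ f, ∀ v ∈ f, m u (C.p v) + m v (C.p u) = 0) :
    ∃ M : E →ₗ[ℝ] E →ₗ[ℝ] ℝ, (∀ x y, M x y + M y x = 0) ∧ ∀ v ∈ f, M (C.p v) = m v := by
  obtain ⟨χ, h1, h2, h3, h4⟩ := C.dual hf
  obtain ⟨n, hn, hno⟩ := hf.K2 (fun v => - m v C.o) 0
  set M : E →ₗ[ℝ] E →ₗ[ℝ] ℝ := ∑ v ∈ f, (χ v).smulRight (m v) + (C.phi f).smulRight n with hM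
  have hMx : ∀ x, M x = ∑ v ∈ f, χ v x • m v + C.phi f x • n := by
    intro x; simp [hM, LinearMap.sum_apply]
  refine ⟨M, fun x y => ?_, fun v hv => ?_⟩
  · have ex : ∀ ψ : E →ₗ[ℝ] ℝ, ∀ y, ψ y = ∑ v ∈ f, χ v y * ψ (C.p v) + C.phi f y * ψ C.o := by
      intro ψ y
      conv_lhs => rw [h4 y]
      simp
    have e : ∀ x y, M x y = ∑ u ∈ f, ∑ v ∈ f, χ u x * χ v y * m u (C.p v)
        + (∑ u ∈ f, χ u x * m u C.o) * C.phi f y - (∑ u ∈ f, χ u y * m u C.o) * C.phi f x := by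
      intro x y
      rw [hMx]
      simp only [LinearMap.add_apply, LinearMap.sum_apply, LinearMap.smul_apply, smul_eq_mul]
      have hny : n y = - ∑ u ∈ f, χ u y * m u C.o := by
        rw [ex n y, hno, mul_zero, add_zero, ← sum_neg_distrib]
        exact sum_congr rfl fun v hv => by rw [hn v hv]; ring
      have : ∀ u ∈ f, χ u x * (m u) y =
          ∑ v ∈ f, χ u x * χ v y * m u (C.p v) + χ u x * m u C.o * C.phi f y := by
        intro u _
        rw [ex (m u) y, mul_add, mul_sum]
        congr 1
        · exact sum_congr rfl fun _ _ => by ring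
        · ring
      rw [sum_congr rfl this, hny, sum_add_distrib, sum_mul]
      ring
    rw [e x y, e y x]
    have : ∑ u ∈ f, ∑ v ∈ f, χ u y * χ v x * m u (C.p v) =
        - ∑ u ∈ f, ∑ v ∈ f, χ u x * χ v y * m u (C.p v) := by
      rw [sum_comm, ← sum_neg_distrib]
      refine sum_congr rfl fun u hu => ?_
      rw [← sum_neg_distrib]
      refine sum_congr rfl fun v hv => ?_
      have := h u hu v hv
      rw [show m v (C.p u) = - m u (C.p v) by linarith]; ring
    rw [this]; ring
  · rw [hMx, hf.zero hv, zero_smul, add_zero, sum_congr rfl fun u hu => by rw [h1 u hu v hv]]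
    simp [hv]
end PC

/-! ### From cones to three-space -/

lemma dd_mul (y1 y2 y3 t1 t2 t3 : V3) : dd y1 y2 y3 * dd t1 t2 t3 =
    dt y1 t1 * (dt y2 t2 * dt y3 t3 - dt y2 t3 * dt y3 t2)
    - dt y1 t2 * (dt y2 t1 * dt y3 t3 - dt y2 t3 * dt y3 t1)
    + dt y1 t3 * (dt y2 t1 * dt y3 t2 - dt y2 t2 * dt y3 t1) := by
  simp only [dd, dt, cr0, cr1, cr2]; ring

lemma dd_smul3 (r1 r2 r3 : ℝ) (t1 t2 t3 : V3) :
    dd (r1 • t1) (r2 • t2) (r3 • t3) = r1 * r2 * r3 * dd t1 t2 t3 := by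
  simp only [dd, dt, cr0, cr1, cr2, Pi.smul_apply, smul_eq_mul]; ring

namespace PC
variable {ι E : Type} [AddCommGroup E] [Module ℝ E] [FiniteDimensional ℝ E] {d : ℕ}
  (C : PC ι E d)

def fcts (κ : Finset ι) : Finset (Finset ι) := C.V.powerset.filter fun h => C.IsFct h ∧ κ ⊆ h

lemma mem_fcts {κ h : Finset ι} : h ∈ C.fcts κ ↔ C.IsFct h ∧ κ ⊆ h := by
  simp only [fcts, mem_filter, mem_powerset]
  exact ⟨fun h => h.2, fun h => ⟨h.1.sub, h⟩⟩

def zz (κ : Finset ι) : E →ₗ[ℝ] ℝ := ((C.fcts κ).card : ℝ)⁻¹ • ∑ h ∈ C.fcts κ, C.phi h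

lemma zz_apply (κ : Finset ι) (x : E) :
    C.zz κ x = ((C.fcts κ).card : ℝ)⁻¹ * ∑ h ∈ C.fcts κ, C.phi h x := by
  simp [zz, LinearMap.sum_apply]

lemma zz_zero {κ : Finset ι} {v : ι} (hv : v ∈ κ) : C.zz κ (C.p v) = 0 := by
  rw [zz_apply, sum_eq_zero, mul_zero]
  intro h hh
  obtain ⟨h1, h2⟩ := C.mem_fcts.1 hh
  exact h1.zero (h2 hv)

lemma zz_o {κ f : Finset ι} (hf : C.IsFct f) (hκ : κ ⊆ f) : C.zz κ C.o = 1 := by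
  rw [zz_apply, sum_congr rfl fun h hh => (C.mem_fcts.1 hh).1.phi_o]
  have : ((C.fcts κ).card : ℝ) ≠ 0 := by
    rw [Nat.cast_ne_zero]
    exact card_ne_zero_of_mem (C.mem_fcts.2 ⟨hf, hκ⟩)
  simp [this]

lemma pivot_fcts {κ h : Finset ι} (hh : h ∈ C.fcts κ) {u : ι} (hu : u ∈ h) (hk : u ∉ κ) :
    ∃ g ∈ C.fcts κ, u ∉ g ∧ h.erase u ⊆ g := by
  obtain ⟨h1, h2⟩ := C.mem_fcts.1 hh
  obtain ⟨g, hg, h3, h4⟩ := C.pivot h1 hu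
  refine ⟨g, C.mem_fcts.2 ⟨hg, fun w hw => h4 (mem_erase.2 ⟨?_, h2 hw⟩)⟩, h3, h4⟩
  rintro rfl; exact hk hw

lemma zz_pos {κ h : Finset ι} (hh : h ∈ C.fcts κ) {u : ι} (hu : u ∈ h) (hk : u ∉ κ) :
    0 < C.zz κ (C.p u) := by
  obtain ⟨g, hg, h3, h4⟩ := C.pivot_fcts hh hu hk
  have huV := (C.mem_fcts.1 hh).1.sub hu
  rw [zz_apply]
  refine mul_pos (inv_pos.2 (Nat.cast_pos.2 (card_pos.2 ⟨g, hg⟩))) ?_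
  exact sum_pos' (fun k hk => (C.mem_fcts.1 hk).1.nn u huV)
    ⟨g, hg, (C.mem_fcts.1 hg).1.pos huV h3⟩

theorem lemD {κ f g : Finset ι} (hf : C.IsFct f) (hg : C.IsFct g) (hκf : κ ⊆ f) (hκg : κ ⊆ g)
    (hcard : κ.card + 3 = d) (hadj : ∃ v ∈ f, v ∉ g ∧ f.erase v ⊆ g) (m : ι → E →ₗ[ℝ] ℝ)
    (hm : ∀ h, C.IsFct h → κ ⊆ h → ∀ u ∈ h, ∀ v ∈ h, m u (C.p v) + m v (C.p u) = 0)
    (h0 : ∀ v ∈ f, m v = 0) : ∀ v ∈ g, m v = 0 := by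
  obtain ⟨v0, hv0f, hv0g, hsub⟩ := hadj
  obtain ⟨χ, hχ1, hχ2, hχ3, -⟩ := C.dual hf
  have hc3 : (f \ κ).card = 3 := by
    rw [card_sdiff_of_subset hκf, hf.card]; omega
  obtain ⟨a, b, c, hab, hac, hbc, habc⟩ := card_eq_three.1 hc3
  set z := C.zz κ with hz
  have hzo : z C.o = 1 := C.zz_o hf hκf
  set T : E → V3 := fun x => ![χ a x, χ b x, χ c x] with hT
  set r : (E →ₗ[ℝ] ℝ) → V3 := fun ψ => ![ψ (C.p a), ψ (C.p b), ψ (C.p c)] with hr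
  have hrT : ∀ ψ : E →ₗ[ℝ] ℝ, (∀ v ∈ κ, ψ (C.p v) = 0) → ψ C.o = 0 →
      ∀ x, ψ x = dt (r ψ) (T x) := by
    intro ψ hk ho x
    have e := LinearMap.congr_fun (hχ3 ψ) x
    rw [← sum_sdiff hκf, habc, sum_eq_zero (s := κ), ho, zero_smul, add_zero, add_zero,
      sum_insert (by simp [hab, hac]), sum_insert (by simp [hbc]), sum_singleton] at e
    · rw [e]
      simp [dt, hT, hr]; ring
    · intro v hv; rw [hk v hv, zero_smul]
  have hmem : ∀ s, s ∈ (C.fcts κ).image (· \ κ) → s ∪ κ ∈ C.fcts κ ∧ Disjoint s κ := by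
    intro s hs
    obtain ⟨h, hh, rfl⟩ := mem_image.1 hs
    have := (C.mem_fcts.1 hh).2
    rw [sdiff_union_of_subset this]
    exact ⟨hh, sdiff_disjoint⟩
  have hmem' : ∀ h, C.IsFct h → κ ⊆ h → h \ κ ∈ (C.fcts κ).image (· \ κ) := fun h h1 h2 =>
    mem_image.2 ⟨h, C.mem_fcts.2 ⟨h1, h2⟩, rfl⟩
  have hzpos : ∀ s ∈ (C.fcts κ).image (· \ κ), ∀ u ∈ s, 0 < z (C.p u) := by
    intro s hs u hu
    obtain ⟨h1, h2⟩ := hmem s hs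
    exact C.zz_pos h1 (mem_union_left _ hu) (disjoint_left.1 h2 hu)
  set P : ι → V3 := fun u => (z (C.p u))⁻¹ • T (C.p u) with hP
  have hrP : ∀ ψ : E →ₗ[ℝ] ℝ, (∀ v ∈ κ, ψ (C.p v) = 0) → ψ C.o = 0 →
      ∀ u, dt (r ψ) (P u) = (z (C.p u))⁻¹ * ψ (C.p u) := by
    intro ψ hk ho u
    rw [hP, hrT ψ hk ho]; simp only [dt_smul]
  have hx : ∀ s ∈ (C.fcts κ).image (· \ κ), ∀ g ∈ (C.fcts κ).image (· \ κ), ∀ u ∈ g,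
      C.phi (s ∪ κ) (C.p u) = z (C.p u) * (1 + dt (r (C.phi (s ∪ κ) - z)) (P u)) := by
    intro s hs g hg u hu
    have hzp := hzpos g hg u hu
    have hF := C.mem_fcts.1 (hmem s hs).1
    rw [hrP]
    · simp only [LinearMap.sub_apply]; field_simp; ring
    · intro v hv
      simp [hF.1.zero (hF.2 hv), hz, C.zz_zero hv]
    · simp [hF.1.phi_o, hzo]
  let S : Dehn ι :=
    { F := (C.fcts κ).image (· \ κ)
      P := P
      x := fun s => r (C.phi (s ∪ κ) - z)
      card3 := by
        intro s hs
        obtain ⟨h1, h2⟩ := hmem s hs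
        have := (C.mem_fcts.1 h1).1.card
        rw [card_union_of_disjoint h2] at this
        omega
      ge := by
        intro s hs g hg u hu
        have hzp := hzpos g hg u hu
        have h1 := hx s hs g hg u hu
        have h2 := (C.mem_fcts.1 (hmem s hs).1).1.nn u
          ((C.mem_fcts.1 (hmem g hg).1).1.sub (mem_union_left _ hu))
        rw [h1] at h2
        have := nonneg_of_mul_nonneg_right h2 hzp
        linarith
      eqiff := by
        intro s hs g hg u hu
        have hzp := hzpos g hg u hu
        have h1 := hx s hs g hg u hu
        have hF := (C.mem_fcts.1 (hmem s hs).1).1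
        constructor
        · intro he
          rw [he] at h1
          have h2 : C.phi (s ∪ κ) (C.p u) = 0 := by rw [h1]; ring
          have h3 := hF.mem ((C.mem_fcts.1 (hmem g hg).1).1.sub (mem_union_left _ hu)) h2
          exact (mem_union.1 h3).resolve_right (disjoint_left.1 (hmem g hg).2 hu)
        · intro hus
          rw [hF.zero (mem_union_left _ hus)] at h1
          have := (mul_eq_zero.1 h1.symm).resolve_left hzp.ne'
          linarith
      det := by
        intro s hs u hu v hv w hw huv huw hvw
        have hF := (C.mem_fcts.1 (hmem s hs).1).1
        have hdis := disjoint_left.1 (hmem s hs).2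
        choose y hy hyo using fun i : ι => hF.K2 (fun j => if j = i then 1 else 0) 0
        have hk : ∀ i ∈ s, ∀ k ∈ κ, y i (C.p k) = 0 := by
          intro i hi k hk
          rw [hy i k (mem_union_right _ hk), if_neg]
          rintro rfl; exact hdis hi hk
        have hd : ∀ i ∈ s, ∀ j ∈ s, dt (r (y i)) (T (C.p j)) = if j = i then 1 else 0 := by
          intro i hi j hj
          rw [← hrT (y i) (hk i hi) (hyo i), hy i j (mem_union_left _ hj)]
        have e := dd_mul (r (y u)) (r (y v)) (r (y w)) (T (C.p u)) (T (C.p v)) (T (C.p w))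
        rw [hd u hu u hu, hd u hu v hv, hd u hu w hw, hd v hv u hu, hd v hv v hv, hd v hv w hw,
          hd w hw u hu, hd w hw v hv, hd w hw w hw] at e
        simp [huv, huv.symm, huw, huw.symm, hvw, hvw.symm] at e
        have hT0 : dd (T (C.p u)) (T (C.p v)) (T (C.p w)) ≠ 0 := by
          intro h; rw [h] at e; simp at e
        simp only [hP, dd_smul3]
        have h1 := (hzpos s hs u hu).ne'
        have h2 := (hzpos s hs v hv).ne'
        have h3 := (hzpos s hs w hw).ne'
        positivity
      nbr := by
        intro s hs w hw
        obtain ⟨h1, h2⟩ := hmem s hs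
        obtain ⟨g, hg, h3, h4⟩ := C.pivot_fcts h1 (mem_union_left _ hw) (disjoint_left.1 h2 hw)
        refine ⟨g \ κ, mem_image.2 ⟨g, hg, rfl⟩, fun h => h3 (mem_sdiff.1 h).1, ?_⟩
        intro i hi
        obtain ⟨h5, h6⟩ := mem_erase.1 hi
        exact mem_sdiff.2 ⟨h4 (mem_erase.2 ⟨h5, mem_union_left _ h6⟩), disjoint_left.1 h2 h6⟩ }
  have hmκ : ∀ s ∈ (C.fcts κ).image (· \ κ), ∀ u ∈ s, ∀ k ∈ κ, m u (C.p k) = 0 := by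
    intro s hs u hu k hk
    obtain ⟨h1, h2⟩ := C.mem_fcts.1 (hmem s hs).1
    have := hm _ h1 h2 u (mem_union_left _ hu) k (mem_union_right _ hk)
    rw [h0 k (hκf hk)] at this
    simpa using this
  set q : ι → E →ₗ[ℝ] ℝ := fun u => m u - m u C.o • z with hq
  have hqk : ∀ s ∈ (C.fcts κ).image (· \ κ), ∀ u ∈ s, ∀ k ∈ κ, q u (C.p k) = 0 := by
    intro s hs u hu k hk
    simp [hq, hmκ s hs u hu k hk, hz, C.zz_zero hk]
  have hqo : ∀ u, q u C.o = 0 := by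
    intro u; simp [hq, hzo]
  set A : ι → V3 := fun u => (z (C.p u))⁻¹ • r (q u) with hA
  have hAP : ∀ s ∈ (C.fcts κ).image (· \ κ), ∀ u ∈ s, ∀ v, dt (P v) (A u) =
      (z (C.p u))⁻¹ * ((z (C.p v))⁻¹ * (m u (C.p v) - m u C.o * z (C.p v))) := by
    intro s hs u hu v
    rw [hA, dt_smul, dt_comm, hrP _ (hqk s hs u hu) (hqo u)]
    simp [hq]
  have hmot : ∀ s ∈ S.F, ∀ u ∈ s, ∀ v ∈ s, dt (S.P u - S.P v) (A u - A v) = 0 := by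
    intro s hs u hu v hv
    have hF := C.mem_fcts.1 (hmem s hs).1
    have hus := mem_union_left κ hu
    have hvs := mem_union_left κ hv
    have e1 := hm _ hF.1 hF.2 u hus u hus
    have e2 := hm _ hF.1 hF.2 v hvs v hvs
    have e3 := hm _ hF.1 hF.2 u hus v hvs
    have e1' : m u (C.p u) = 0 := by linarith
    have e2' : m v (C.p v) = 0 := by linarith
    have e3' : m v (C.p u) = - m u (C.p v) := by linarith
    have hzu := (hzpos s hs u hu).ne'
    have hzv := (hzpos s hs v hv).ne'
    change dt (P u - P v) (A u - A v) = 0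
    rw [dt_sub, sub_dt, sub_dt, hAP s hs u hu, hAP s hs u hu, hAP s hs v hv, hAP s hs v hv,
      e1', e2', e3']
    field_simp
    ring
  have hv0κ : v0 ∉ κ := fun h => hv0g (hκg h)
  have hc2 : ((f \ κ).erase v0).card = 2 := by
    rw [card_erase_of_mem (mem_sdiff.2 ⟨hv0f, hv0κ⟩), hc3]
  obtain ⟨u, v, huv, he⟩ := card_eq_two.1 hc2
  have hu : u ∈ (f \ κ).erase v0 := by rw [he]; simp
  have hv : v ∈ (f \ κ).erase v0 := by rw [he]; simp
  have hsub' : ∀ w, w ∈ (f \ κ).erase v0 → w ∈ f \ κ ∧ w ∈ g \ κ := by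
    intro w hw
    obtain ⟨h1, h2⟩ := mem_erase.1 hw
    obtain ⟨h3, h4⟩ := mem_sdiff.1 h2
    exact ⟨h2, mem_sdiff.2 ⟨hsub (mem_erase.2 ⟨h1, h3⟩), h4⟩⟩
  have hA0 := S.main A hmot (f := f \ κ) (g := g \ κ) (hmem' f hf hκf) (hmem' g hg hκg)
    (by
      intro h
      have : v0 ∈ g \ κ := by rw [← h]; exact mem_sdiff.2 ⟨hv0f, hv0κ⟩
      exact hv0g (mem_sdiff.1 this).1)
    huv (hsub' u hu).1 (hsub' v hv).1 (hsub' u hu).2 (hsub' v hv).2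
    (by
      intro w hw
      have : m w = 0 := h0 w (mem_sdiff.1 hw).1
      simp only [hA, hq, this]
      apply v3_ext <;> simp [hr])
  intro w hw
  by_cases hwκ : w ∈ κ
  · exact h0 w (hκf hwκ)
  have hwg : w ∈ g \ κ := mem_sdiff.2 ⟨hw, hwκ⟩
  have hgF := hmem' g hg hκg
  have hzw := (hzpos _ hgF w hwg).ne'
  have h1 := hA0 w hwg
  simp only [hA, smul_eq_zero, inv_eq_zero, hzw, false_or] at h1
  have h2 : ∀ x, m w x = m w C.o * z x := by
    intro x
    have := hrT _ (hqk _ hgF w hwg) (hqo w) x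
    rw [h1, zero_dt] at this
    simp [hq] at this
    linarith
  have h3 := hm g hg hκg w hw w hw
  have h4 : m w C.o * z (C.p w) = 0 := by rw [← h2]; linarith
  have h5 := (mul_eq_zero.1 h4).resolve_right hzw
  ext x
  rw [h2, h5]; simp
end PC

/-! ### Rigidity of stars -/
namespace PC
variable {ι E : Type} [AddCommGroup E] [Module ℝ E] [FiniteDimensional ℝ E] {d : ℕ}
  (C : PC ι E d)

theorem rigid {σ f g : Finset ι} (hσ : σ.card + 3 ≤ d) (hf : C.IsFct f) (hg : C.IsFct g)
    (hσf : σ ⊆ f) (hσg : σ ⊆ g) {a b : ι} (ha : a ∈ f) (hb : b ∈ g) (m : ι → E →ₗ[ℝ] ℝ)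
    (hm : ∀ h, C.IsFct h → σ ⊆ h → ∀ u ∈ h, ∀ v ∈ h, m u (C.p v) + m v (C.p u) = 0) :
    m a (C.p b) + m b (C.p a) = 0 := by
  obtain ⟨M, hM, hMf⟩ := C.skew hf m (hm f hf hσf)
  have key : ∀ v ∈ g, m v - M (C.p v) = 0 := by
    refine C.conn (σ := σ) (fun h => ∀ v ∈ h, m v - M (C.p v) = 0) hg hσg ?_ f hf hσf ?_
    · intro h h' hh hh' hs hs' hadj hQ
      obtain ⟨v, hv, hv', hsub⟩ := hadj
      have h1 : σ ⊆ h.erase v := fun w hw =>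
        mem_erase.2 ⟨fun he => hv' (he ▸ hs' hw), hs hw⟩
      have h2 : (h.erase v).card = d - 1 := by rw [card_erase_of_mem hv, hh.card]
      obtain ⟨κ, hk1, hk2, hk3⟩ := exists_subsuperset_card_eq (n := d - 3) h1 (by omega) (by omega)
      refine C.lemD hh hh' (hk2.trans (erase_subset _ _)) (hk2.trans hsub) (by omega)
        ⟨v, hv, hv', hsub⟩ (fun v => m v - M (C.p v)) ?_ hQ
      intro k hk hkk x hx y hy
      have e1 := hm k hk (hk1.trans hkk) x hx y hy
      have e2 := hM (C.p x) (C.p y)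
      simp only [LinearMap.sub_apply]
      linarith
    · intro v hv
      rw [hMf v hv, sub_self]
  have e1 := hMf a ha
  have e2 := sub_eq_zero.1 (key b hb)
  rw [← e1, e2]
  exact hM _ _
end PC

/-! ### The cone over a polytope -/
section
variable {d : ℕ}

lemma dotR_add (x y z : Fin d → ℝ) : dotR x (y + z) = dotR x y + dotR x z := by
  simp [dotR, mul_add, sum_add_distrib]
lemma dotR_smul (c : ℝ) (x y : Fin d → ℝ) : dotR x (c • y) = c * dotR x y := by
  simp only [dotR, mul_sum, Pi.smul_apply, smul_eq_mul]
  exact sum_congr rfl fun _ _ => by ring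
lemma dotR_comm (x y : Fin d → ℝ) : dotR x y = dotR y x := by
  simp only [dotR]; exact sum_congr rfl fun _ _ => by ring
lemma dotR_sub (x y z : Fin d → ℝ) : dotR x (y - z) = dotR x y - dotR x z := by
  simp [dotR, mul_sub, sum_sub_distrib]
lemma sub_dotR (x y z : Fin d → ℝ) : dotR (y - z) x = dotR y x - dotR z x := by
  simp [dotR, sub_mul, sum_sub_distrib]

def hp (v : Fin d → ℝ) : (Fin d → ℝ) × ℝ := (v, 1)

lemma phi_hp (φ : (Fin d → ℝ) × ℝ →ₗ[ℝ] ℝ) (x : Fin d → ℝ) :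
    φ (hp x) = φ (x, 0) + φ (0, 1) := by
  rw [← map_add]; simp [hp]

lemma span_hp (P : SPolytope d) (φ : (Fin d → ℝ) × ℝ →ₗ[ℝ] ℝ) (h : ∀ v ∈ P.V, φ (hp v) = 0) :
    φ = 0 := by
  have h1 : ∀ x : Fin d → ℝ, φ (hp x) = 0 := by
    intro x
    have hx : x ∈ affineSpan ℝ (P.V : Set (Fin d → ℝ)) := by rw [P.span_top]; trivial
    refine affineSpan_induction (p := fun x => φ (hp x) = 0) hx h ?_
    intro c u v w hu hv hw
    rw [phi_hp] at *
    have : ((c • (u -ᵥ v) +ᵥ w, 0) : (Fin d → ℝ) × ℝ) =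
        c • ((u, 0) - (v, 0)) + ((w, 0) : (Fin d → ℝ) × ℝ) := by
      ext <;> simp
    rw [this, map_add, map_smul, map_sub]
    rw [show φ (u, 0) = φ (v, 0) by linarith]
    simp [hw]
  have h0 : φ (0, 1) = 0 := h1 0
  apply LinearMap.ext
  rintro ⟨x, r⟩
  have h2 := h1 x
  rw [phi_hp, h0, add_zero] at h2
  have : ((x, r) : (Fin d → ℝ) × ℝ) = (x, 0) + r • (0, 1) := by ext <;> simp
  rw [this, map_add, map_smul, h2, h0]; simp

/-- The supporting functional on the affine level. -/
lemma face_of_phi (P : SPolytope d) (φ : (Fin d → ℝ) × ℝ →ₗ[ℝ] ℝ) (h0 : φ ≠ 0)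
    (h : ∀ v ∈ P.V, 0 ≤ φ (hp v)) :
    IsProperFace P.V {y ∈ polyBody P.V | φ (hp y) = 0} := by
  refine ⟨⟨- φ.comp (LinearMap.inl ℝ (Fin d → ℝ) ℝ), φ (0, 1), ?_, ?_⟩, ?_⟩
  · intro y hy
    have hconv : Convex ℝ {y : Fin d → ℝ |
        (- φ.comp (LinearMap.inl ℝ (Fin d → ℝ) ℝ)) y ≤ φ (0, 1)} :=
      convex_halfSpace_le (LinearMap.isLinear _) _
    refine convexHull_min ?_ hconv hy
    intro v hv
    have := h v hv
    rw [phi_hp] at this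
    simp
    linarith
  · ext y
    simp only [Set.mem_setOf_eq, and_congr_right_iff]
    intro _
    rw [phi_hp]
    simp
    constructor <;> intro <;> linarith
  · intro he
    apply h0
    apply span_hp P
    intro v hv
    have : v ∈ polyBody P.V := subset_convexHull ℝ _ hv
    rw [← he] at this
    exact this.2

lemma ind_hp {S : Set (Fin d → ℝ)}
    (h : AffineIndependent ℝ (fun x : {y : Fin d → ℝ // y ∈ S} => (x : Fin d → ℝ))) :
    LinearIndepOn ℝ hp S := by
  rw [affineIndependent_iff] at h
  unfold LinearIndepOn
  rw [linearIndependent_iff']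
  intro s w hw
  apply h s w
  · have := congrArg Prod.snd hw
    simpa [hp, Prod.snd_sum] using this
  · have := congrArg Prod.fst hw
    simpa [hp, Prod.fst_sum] using this

def cone (P : SPolytope d) : PC (Fin d → ℝ) ((Fin d → ℝ) × ℝ) d where
  V := P.V
  p := hp
  fr := by simp
  span := span_hp P
  ind := by
    intro φ h0 h
    have := (P.simplicial _ (face_of_phi P φ h0 h)).1
    have h2 := ind_hp this
    have hE : {v | v ∈ P.V ∧ φ (hp v) = 0} =
        (P.V : Set (Fin d → ℝ)) ∩ {y ∈ polyBody P.V | φ (hp y) = 0} := by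
      apply Set.ext
      intro v
      exact ⟨fun h => ⟨h.1, subset_convexHull ℝ _ h.1, h.2⟩, fun h => ⟨h.1, h.2.2⟩⟩
    rw [hE]; exact h2

lemma fct_of_bface (P : SPolytope d) {s : Finset (Fin d → ℝ)} (h : BFace P s) :
    ∃ f, (cone P).IsFct f ∧ s ⊆ f := by
  obtain ⟨hs, F, ⟨⟨f, c, hle, hF⟩, hne⟩, hsF⟩ := h
  set φ : (Fin d → ℝ) × ℝ →ₗ[ℝ] ℝ :=
    c • LinearMap.snd ℝ (Fin d → ℝ) ℝ - f.comp (LinearMap.fst ℝ (Fin d → ℝ) ℝ) with hφ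
  have hφv : ∀ v, φ (hp v) = c - f v := by intro v; simp [hφ, hp]
  have h0 : φ ≠ 0 := by
    intro h0
    apply hne
    rw [hF]
    ext y
    simp only [Set.mem_setOf_eq, and_iff_left_iff_imp]
    intro _
    have := hφv y
    rw [h0] at this
    simp at this; linarith
  have hnn : (cone P).NN φ := by
    intro v hv
    change 0 ≤ φ (hp v)
    rw [hφv]
    have := hle v (subset_convexHull ℝ _ hv)
    linarith
  obtain ⟨g, hg, hsub⟩ := (cone P).exists_fct h0 hnn
  refine ⟨g, hg, fun v hv => hsub ((cone P).mem_Z.2 ⟨hs hv, ?_⟩)⟩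
  change φ (hp v) = 0
  have := hsF hv
  rw [hF] at this
  rw [hφv, this.2, sub_self]

lemma bface_of_fct (P : SPolytope d) {f s : Finset (Fin d → ℝ)} (h : (cone P).IsFct f)
    (hs : s ⊆ f) : BFace P s := by
  refine ⟨hs.trans h.sub, _, face_of_phi P ((cone P).phi f) h.ne h.nn, ?_⟩
  intro v hv
  exact ⟨subset_convexHull ℝ _ (h.sub (hs hv)), h.zero (hs hv)⟩

def mh (m : (Fin d → ℝ) → Fin d → ℝ) (v : Fin d → ℝ) : (Fin d → ℝ) × ℝ →ₗ[ℝ] ℝ where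
  toFun x := dotR (m v) x.1 - dotR (m v) v * x.2
  map_add' x y := by simp [dotR_add]; ring
  map_smul' c x := by simp [dotR_smul]; ring

lemma mh_sum (m : (Fin d → ℝ) → Fin d → ℝ) (u v : Fin d → ℝ) :
    mh m u (hp v) + mh m v (hp u) = - dotR (u - v) (m u - m v) := by
  simp only [mh, hp, LinearMap.coe_mk, AddHom.coe_mk, dotR_sub, sub_dotR]
  rw [dotR_comm u, dotR_comm v, dotR_comm u, dotR_comm v]; ring

theorem star_rigid (P : SPolytope d) {σ : Finset (Fin d → ℝ)} (hσ : σ.card + 3 ≤ d)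
    {a b : Fin d → ℝ} (ha : BFace P (insert a σ)) (hb : BFace P (insert b σ))
    (m : (Fin d → ℝ) → Fin d → ℝ)
    (hm : ∀ u v, u ≠ v → ({u, v} : Finset (Fin d → ℝ)) ∈ (starGraph P σ).edges →
      dotR (u - v) (m u - m v) = 0) :
    dotR (a - b) (m a - m b) = 0 := by
  obtain ⟨f, hf, hsf⟩ := fct_of_bface P ha
  obtain ⟨g, hg, hsg⟩ := fct_of_bface P hb
  have := (cone P).rigid hσ hf hg ((subset_insert _ _).trans hsf) ((subset_insert _ _).trans hsg)
    (hsf (mem_insert_self _ _)) (hsg (mem_insert_self _ _)) (mh m) (by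
      intro h hh hs u hu v hv
      change mh m u (hp v) + mh m v (hp u) = 0
      rw [mh_sum, neg_eq_zero]
      by_cases huv : u = v
      · rw [huv]; simp [dotR]
      apply hm u v huv
      have hsub : ({u, v} : Finset (Fin d → ℝ)) ⊆ h := by
        intro w hw; simp at hw; rcases hw with rfl | rfl <;> assumption
      simp only [starGraph, mem_filter, mem_powerset]
      exact ⟨hsub.trans hh.sub, card_pair huv, bface_of_fct P hh (union_subset hsub hs)⟩)
  change mh m a (hp b) + mh m b (hp a) = 0 at this
  rw [mh_sum, neg_eq_zero] at this
  exact this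

/-! ### Duality between motions and stresses -/

def RR (g : Finset (Fin d → ℝ)) : ((Fin d → ℝ) → Fin d → ℝ) →ₗ[ℝ] ℝ where
  toFun m := ∑ u ∈ g, ∑ v ∈ g, dotR (u - v) (m u - m v)
  map_add' m n := by
    rw [← sum_add_distrib]
    refine sum_congr rfl fun u _ => ?_
    rw [← sum_add_distrib]
    refine sum_congr rfl fun v _ => ?_
    rw [← dotR_add]; congr 1; simp only [Pi.add_apply]; abel
  map_smul' c m := by
    simp only [RingHom.id_apply, smul_eq_mul, mul_sum]
    refine sum_congr rfl fun u _ => sum_congr rfl fun v _ => ?_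
    rw [← dotR_smul]; simp [smul_sub]

lemma RR_pair {a b : Fin d → ℝ} (hab : a ≠ b) (m : (Fin d → ℝ) → Fin d → ℝ) :
    RR {a, b} m = 2 * dotR (a - b) (m a - m b) := by
  have h1 : ∀ x : Fin d → ℝ, dotR (x - x) (m x - m x) = 0 := by intro x; simp [dotR]
  have h2 : dotR (b - a) (m b - m a) = dotR (a - b) (m a - m b) := by
    simp only [dotR]; exact sum_congr rfl fun _ _ => by simp; ring
  simp only [RR, LinearMap.coe_mk, AddHom.coe_mk, sum_pair hab, h1, h2]; ring

lemma RR_single {g : Finset (Fin d → ℝ)} (hg : g.card = 2) (v w : Fin d → ℝ) :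
    RR g (Pi.single v w) = if v ∈ g then 2 * dotR (∑ u ∈ g.erase v, (v - u)) w else 0 := by
  obtain ⟨a, b, hab, rfl⟩ := card_eq_two.1 hg
  rw [RR_pair hab]
  by_cases hva : v = a
  · subst hva
    have : ({v, b} : Finset (Fin d → ℝ)).erase v = {b} := by
      ext x; simp; grind
    rw [this]
    simp [Pi.single_eq_of_ne hab.symm]
  by_cases hvb : v = b
  · subst hvb
    have : ({a, v} : Finset (Fin d → ℝ)).erase v = {a} := by
      ext x; simp; grind
    rw [this]
    simp [Pi.single_eq_of_ne hab, dotR]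
    rw [← mul_neg, ← sum_neg_distrib]
    congr 1
    exact sum_congr rfl fun _ _ => by ring
  · rw [if_neg (by simp [hva, hvb]), Pi.single_eq_of_ne (Ne.symm hva),
      Pi.single_eq_of_ne (Ne.symm hvb)]
    simp [dotR]

lemma dual_stress {G : Finset (Finset (Fin d → ℝ))} {e : Finset (Fin d → ℝ)}
    (hG : ∀ g ∈ G, g.card = 2) (he : e.card = 2) (heG : e ∉ G)
    (h : ∀ m, (∀ g ∈ G, RR g m = 0) → RR e m = 0) :
    ∃ ω : Finset (Fin d → ℝ) → ℝ, ω e ≠ 0 ∧ ∀ v : Fin d → ℝ,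
      (∑ g ∈ (insert e G).filter (fun g => v ∈ g), ∑ u ∈ g.erase v, ω g • (v - u)) = 0 := by
  have h1 : RR e ∈ Submodule.span ℝ (Set.range fun g : G => RR (d := d) g) := by
    apply mem_span_of_iInf_ker_le_ker
    intro m hm
    rw [Submodule.mem_iInf] at hm
    exact h m fun g hg => hm ⟨g, hg⟩
  rw [Submodule.mem_span_range_iff_exists_fun] at h1
  obtain ⟨c, hc⟩ := h1
  set ω : Finset (Fin d → ℝ) → ℝ := fun g => if hg : g ∈ G then c ⟨g, hg⟩ else -1 with hω
  have hωe : ω e = -1 := by simp [hω, heG]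
  refine ⟨ω, by rw [hωe]; norm_num, fun v => ?_⟩
  have hsum : ∀ m, ∑ g ∈ insert e G, ω g * RR g m = 0 := by
    intro m
    rw [sum_insert heG, hωe, ← hc, ← sum_coe_sort G]
    simp only [LinearMap.sum_apply, LinearMap.smul_apply, smul_eq_mul]
    have : ∀ g : G, ω g = c g := by intro g; simp [hω, g.2]
    simp only [this]; ring
  have hdot : ∀ w, dotR (∑ g ∈ (insert e G).filter (fun g => v ∈ g),
      ∑ u ∈ g.erase v, ω g • (v - u)) w = 0 := by
    intro w
    have e1 := hsum (Pi.single v w)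
    have e2 : ∑ g ∈ insert e G, ω g * RR g (Pi.single v w) =
        ∑ g ∈ (insert e G).filter (fun g => v ∈ g),
          2 * (ω g * dotR (∑ u ∈ g.erase v, (v - u)) w) := by
      rw [sum_filter]
      refine sum_congr rfl fun g hg => ?_
      rw [RR_single]
      · split_ifs
        · ring
        · ring
      · rcases mem_insert.1 hg with rfl | hg
        · exact he
        · exact hG g hg
    rw [e2, ← mul_sum] at e1
    have e3 := (mul_eq_zero.1 e1).resolve_left two_ne_zero
    rw [← e3]
    rw [dotR_comm]
    have hs : ∀ (A : Finset (Finset (Fin d → ℝ))) (B : Finset (Fin d → ℝ) → Fin d → ℝ),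
        dotR w (∑ g ∈ A, ω g • B g) = ∑ g ∈ A, ω g * dotR (B g) w := by
      intro A B
      induction A using Finset.induction_on with
      | empty => simp [dotR]
      | insert x A hx ih => rw [sum_insert hx, sum_insert hx, dotR_add, ih, dotR_smul, dotR_comm w]
    rw [← hs]
    simp only [smul_sum]
  funext i
  have := hdot (Pi.single i 1)
  simpa [dotR, Pi.single_apply] using this
end
end Rig

/-- Let `d ≥ 4`, `P` a simplicial `d`-polytope with natural embedding,
`τ` a missing face of `∂P` with `3 ≤ |τ| ≤ d - 1`, `e ⊆ τ` a 2-element subset, and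
`τ' = τ \ e`. Then there is a stress on the framework whose graph is the graph of
`st(τ')` together with the extra edge `e`, that is nonzero on `e`. -/
theorem stmt7 {d : ℕ} (hd : 4 ≤ d) (P : SPolytope d) (τ e : Finset (Fin d → ℝ))
    (hτ : IsMissingFace P τ) (h3 : 3 ≤ τ.card) (hub : τ.card ≤ d - 1)
    (he : e ⊆ τ) (he2 : e.card = 2) :
    ∃ ω : Finset (Fin d → ℝ) → ℝ,
      IsStress
        (⟨(starGraph P (τ \ e)).verts ∪ e,
          insert e (starGraph P (τ \ e)).edges⟩ : FinGraph (Fin d → ℝ))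
        (fun x => x) ω ∧
      ω e ≠ 0 := by
  obtain ⟨a, b, hab, rfl⟩ := card_eq_two.1 he2
  obtain ⟨hτV, hτn, hτs⟩ := hτ
  have hcard : (τ \ {a, b}).card + 2 = τ.card := by
    rw [card_sdiff_of_subset he, he2]; omega
  have haτ : a ∈ τ := he (by simp)
  have hbτ : b ∈ τ := he (by simp)
  have hface : ∀ x y : Fin d → ℝ, x ≠ y → x ∈ τ → y ∈ τ → (∀ w, w ∈ τ \ {a, b} → w ≠ y) →
      BFace P (insert x (τ \ {a, b})) := by
    intro x y hxy hx hy hw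
    apply hτs
    refine (Finset.ssubset_iff_of_subset ?_).2 ⟨y, hy, ?_⟩
    · exact insert_subset hx sdiff_subset
    · intro h
      rcases mem_insert.1 h with h | h
      · exact hxy h.symm
      · exact hw y h rfl
  have hA := hface a b hab haτ hbτ (by
    intro w hw h; subst h; simp at hw)
  have hB := hface b a hab.symm hbτ haτ (by
    intro w hw h; subst h; simp at hw)
  have hcard2 : ∀ g ∈ (starGraph P (τ \ {a, b})).edges, g.card = 2 := by
    intro g hg
    exact (mem_filter.1 hg).2.1
  have hnot : ({a, b} : Finset (Fin d → ℝ)) ∉ (starGraph P (τ \ {a, b})).edges := by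
    intro h
    have := (mem_filter.1 h).2.2
    rw [union_sdiff_of_subset he] at this
    exact hτn this
  obtain ⟨ω, h1, h2⟩ := Rig.dual_stress hcard2 he2 hnot (by
    intro m hm
    rw [Rig.RR_pair hab, Rig.star_rigid P (by omega) hA hB m, mul_zero]
    intro u v huv hg
    have := hm _ hg
    rw [Rig.RR_pair huv] at this
    exact (mul_eq_zero.1 this).resolve_left two_ne_zero)
  refine ⟨ω, fun v _ => ?_, h1⟩
  have h3 := h2 v
  convert h3
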